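/- arXiv:math/0407152 — 2 statements merged into one kernel-verified Lean document; each statement's English description precedes it below -/
import Mathlib

section
/- Let R be a finitely generated prime k-algebra of PI-degree n. Then R is isomorphic as a k-algebra to k_n[X] for some irreducible n-variety X. Moreover, X is uniquely determined by R, up to isomorphism of n-varieties. -/
set_option linter.unusedSectionVars false

noncomputable section

universe u

-- Throughout, `k` is an algebraically closed base field of characteristic zero.
variable (k : Type) [Field k] [IsAlgClosed k] [CharZero k]

/-- Index type for the `m·n²` commuting variables `x_{ij}^{(h)}`. -/
abbrev MIdx (n m : ℕ) := Fin m × Fin n × Fin n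

/-- The commutative polynomial ring `k[x_{ij}^{(h)}]`. -/
abbrev PolyRing (n m : ℕ) := MvPolynomial (MIdx n m) k

/-- Matrices over the polynomial ring `k[x_{ij}^{(h)}]`. -/
abbrev MatPoly (n m : ℕ) := Matrix (Fin n) (Fin n) (PolyRing k n m)

/-- The space `(M_n)^m` of `m`-tuples of `n×n` matrices over `k`. -/
abbrev MTuple (n m : ℕ) := Fin m → Matrix (Fin n) (Fin n) k

/-- The `h`-th generic `n×n` matrix `X_h = (x_{ij}^{(h)})`. -/
def genericMatrix (n m : ℕ) (h : Fin m) : MatPoly k n m :=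
  Matrix.of fun i j => MvPolynomial.X (h, i, j)

/-- `G_{m,n}`, the algebra of `m` generic `n×n` matrices: the `k`-subalgebra of
`M_n(k[x_{ij}^{(h)}])` generated by the generic matrices. -/
def GMN (n m : ℕ) : Subalgebra k (MatPoly k n m) :=
  Algebra.adjoin k (Set.range (genericMatrix k n m))

/-- Evaluation of the commuting variables at a point `a ∈ (M_n)^m`. -/
def polyEval {n m : ℕ} (a : MTuple k n m) : PolyRing k n m →ₐ[k] k :=
  MvPolynomial.aeval fun x : MIdx n m => a x.1 x.2.1 x.2.2

/-- Evaluation of matrix-valued polynomials at a point `a ∈ (M_n)^m`; under this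
map an element of `G_{m,n}` (or `T_{m,n}`) becomes a `PGL_n`-equivariant polynomial
map `(M_n)^m → M_n`. -/
def evalMat {n m : ℕ} (a : MTuple k n m) :
    MatPoly k n m →ₐ[k] Matrix (Fin n) (Fin n) k :=
  (polyEval k a).mapMatrix

/-- The scalar matrix `tr(p)·1 ∈ M_n(k[x_{ij}^{(h)}])`. -/
def traceScalar {n m : ℕ} (p : MatPoly k n m) : MatPoly k n m :=
  algebraMap (PolyRing k n m) (MatPoly k n m) (Matrix.trace p)

/-- `T_{m,n}`, the trace ring of `G_{m,n}`: the `k`-algebra generated inside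
`M_n(k[x_{ij}^{(h)}])` by `G_{m,n}` together with the traces of its elements. -/
def TMN (n m : ℕ) : Subalgebra k (MatPoly k n m) :=
  Algebra.adjoin k ((GMN k n m : Set (MatPoly k n m)) ∪
    (traceScalar k '' (GMN k n m : Set (MatPoly k n m))))

lemma GMN_le_TMN (n m : ℕ) : GMN k n m ≤ TMN k n m :=
  fun _ hx => Algebra.subset_adjoin (Or.inl hx)

/-- The inclusion `G_{m,n} → T_{m,n}`. -/
def inclGT (n m : ℕ) : ↥(GMN k n m) →+* ↥(TMN k n m) :=
  (Subalgebra.inclusion (GMN_le_TMN k n m) : ↥(GMN k n m) →ₐ[k] ↥(TMN k n m)).toRingHom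

/-- `U_{m,n}`: the set of `m`-tuples of `n×n` matrices generating `M_n` as a
`k`-algebra. -/
def genTuples (n m : ℕ) : Set (MTuple k n m) :=
  {a | Algebra.adjoin k (Set.range a) = ⊤}

/-- Simultaneous conjugation of an `m`-tuple by `g ∈ GL_n(k)`; since scalar
matrices act trivially, this is the `PGL_n`-action on `(M_n)^m`. -/
def conjAct {n m : ℕ} (g : GL (Fin n) k) (a : MTuple k n m) : MTuple k n m :=
  fun i =>
    (g : Matrix (Fin n) (Fin n) k) * a i * ((g⁻¹ : GL (Fin n) k) : Matrix (Fin n) (Fin n) k)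

/-- Zariski closed subsets of `(M_n)^m`. -/
def IsZClosed {n m : ℕ} (C : Set (MTuple k n m)) : Prop :=
  ∃ S : Set (PolyRing k n m), C = {a | ∀ p ∈ S, polyEval k a p = 0}

/-- `X` is an `n`-variety: a closed `PGL_n`-invariant subvariety of `U_{m,n}`,
i.e. `X = X̄ ∩ U_{m,n}` where `X̄` is the Zariski closure of `X` in `(M_n)^m`. -/
def IsNVariety {n m : ℕ} (X : Set (MTuple k n m)) : Prop :=
  X ⊆ genTuples k n m ∧
  (∀ g : GL (Fin n) k, ∀ a ∈ X, conjAct k g a ∈ X) ∧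
  ∃ C, IsZClosed k C ∧ X = C ∩ genTuples k n m

/-- Irreducibility of a subset of `(M_n)^m` with respect to the Zariski topology. -/
def IsIrredSubset {n m : ℕ} (X : Set (MTuple k n m)) : Prop :=
  X.Nonempty ∧ ∀ C₁ C₂ : Set (MTuple k n m), IsZClosed k C₁ → IsZClosed k C₂ →
    X ⊆ C₁ ∪ C₂ → X ⊆ C₁ ∨ X ⊆ C₂

/-- The zero locus in `U_{m,n}` of a set of matrix-valued polynomials. -/
def zeroLocus {n m : ℕ} (S : Set (MatPoly k n m)) : Set (MTuple k n m) :=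
  {a | a ∈ genTuples k n m ∧ ∀ p ∈ S, evalMat k a p = 0}

/-- The zero locus in `U_{m,n}` of a two-sided ideal of a subalgebra `A` of
`M_n(k[x_{ij}^{(h)}])` (such as `G_{m,n}` or `T_{m,n}`). -/
def zeroLocusI {n m : ℕ} {A : Subalgebra k (MatPoly k n m)} (J : TwoSidedIdeal ↥A) :
    Set (MTuple k n m) :=
  {a | a ∈ genTuples k n m ∧ ∀ p : ↥A, p ∈ J → evalMat k a (p : MatPoly k n m) = 0}

/-- The vanishing (two-sided) ideal of a subset `X ⊆ (M_n)^m` in a subalgebra `A`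
of `M_n(k[x_{ij}^{(h)}])`; for `A = G_{m,n}` this is `I(X)`, for `A = T_{m,n}`
this is `I_T(X)`. -/
def vanishIdeal {n m : ℕ} (A : Subalgebra k (MatPoly k n m)) (X : Set (MTuple k n m)) :
    TwoSidedIdeal ↥A :=
  TwoSidedIdeal.mk' {p : ↥A | ∀ a ∈ X, evalMat k a (p : MatPoly k n m) = 0}
    (fun a _ => by simp)
    (fun {p q} hp hq a ha => by
      have : ((p + q : ↥A) : MatPoly k n m) = (p : MatPoly k n m) + q := rfl
      simp [this, map_add, hp a ha, hq a ha])
    (fun {p} hp a ha => by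
      have : ((-p : ↥A) : MatPoly k n m) = -(p : MatPoly k n m) := rfl
      simp [this, map_neg, hp a ha])
    (fun {p q} hq a ha => by
      have : ((p * q : ↥A) : MatPoly k n m) = (p : MatPoly k n m) * q := rfl
      simp [this, map_mul, hq a ha])
    (fun {p q} hp a ha => by
      have : ((p * q : ↥A) : MatPoly k n m) = (p : MatPoly k n m) * q := rfl
      simp [this, map_mul, hp a ha])

/-- Restriction: a matrix-valued polynomial gives an `M_n`-valued function on `X`. -/
def restrictTo {n m : ℕ} (X : Set (MTuple k n m)) :
    MatPoly k n m →ₐ[k] (X → Matrix (Fin n) (Fin n) k) :=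
  Pi.algHom k _ fun a => evalMat k a.val

/-- The PI-coordinate ring `k_n[X] = G_{m,n}/I(X)`, realized concretely as the
algebra of all restrictions to `X` of elements of `G_{m,n}` (i.e. of
`PGL_n`-equivariant morphisms `X → M_n` coming from `G_{m,n}`). -/
def coordRing {n m : ℕ} (X : Set (MTuple k n m)) :
    Subalgebra k (X → Matrix (Fin n) (Fin n) k) :=
  (GMN k n m).map (restrictTo k X)

/-- The ring `T_{m,n}/I_T(X)`, realized concretely as the algebra of all
restrictions to `X` of elements of `T_{m,n}`. -/
def coordTraceRing {n m : ℕ} (X : Set (MTuple k n m)) :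
    Subalgebra k (X → Matrix (Fin n) (Fin n) k) :=
  (TMN k n m).map (restrictTo k X)

/-- A ring is prime if it is nonzero and `a·R·b = 0` implies `a = 0` or `b = 0`. -/
def IsPrimeRing (R : Type u) [Ring R] : Prop :=
  Nontrivial R ∧ ∀ a b : R, (∀ x : R, a * x * b = 0) → a = 0 ∨ b = 0

/-- `Q` is a central simple algebra of degree `n`: a simple ring whose center is a
field, and which has dimension `n²` over its center. -/
def IsCSAOfDegree (n : ℕ) (Q : Type u) [Ring Q] : Prop :=
  IsSimpleRing Q ∧
  ∃ (K : Type u) (_ : Field K) (_ : Algebra K Q),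
    (algebraMap K Q).range = Subring.center Q ∧ Module.finrank K Q = n ^ 2

/-- A (prime PI-) ring `R` has PI-degree `n` if its total ring of fractions — the
central localization of `R` at its nonzero central elements — is a central simple
algebra of degree `n`. -/
def HasPIDegree (n : ℕ) (R : Type u) [Ring R] : Prop :=
  ∃ (Q : Type u) (_ : Ring Q) (f : R →+* Q),
    Function.Injective f ∧
    (∀ c ∈ Subring.center R, c ≠ 0 → IsUnit (f c)) ∧
    (∀ q : Q, ∃ r : R, ∃ c ∈ Subring.center R, c ≠ 0 ∧ q * f c = f r) ∧
    IsCSAOfDegree n Q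

/-- The quotient of a ring by a two-sided ideal. -/
abbrev idealQuot {R : Type u} [Ring R] (J : TwoSidedIdeal R) : Type u := J.ringCon.Quotient

/-- `Spec_n(R)`: the set of prime (two-sided) ideals `J` of `R` such that `R/J` is a
prime ring of PI-degree `n`. -/
def SpecN (n : ℕ) (R : Type u) [Ring R] : Set (TwoSidedIdeal R) :=
  {J | IsPrimeRing (idealQuot J) ∧ HasPIDegree n (idealQuot J)}

/-- A regular map of `n`-varieties `X → Y ⊆ U_{l,n}`: a map of the form
`a ↦ (f₁(a), …, f_l(a))` with each `f_i ∈ k_n[X]`, i.e. each component is the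
restriction to `X` of an element of `G_{m,n}`. -/
def IsRegMapOn {n m l : ℕ} (X : Set (MTuple k n m)) (Y : Set (MTuple k n l))
    (φ : MTuple k n m → MTuple k n l) : Prop :=
  (∀ a ∈ X, φ a ∈ Y) ∧
  ∃ F : Fin l → MatPoly k n m, (∀ i, F i ∈ GMN k n m) ∧
    ∀ a ∈ X, ∀ i, φ a i = evalMat k a (F i)

/-- `X` and `Y` are isomorphic `n`-varieties: there are mutually inverse regular
maps of `n`-varieties between them. -/
def NIsomorphic {n m l : ℕ} (X : Set (MTuple k n m)) (Y : Set (MTuple k n l)) : Prop :=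
  ∃ (φ : MTuple k n m → MTuple k n l) (ψ : MTuple k n l → MTuple k n m),
    IsRegMapOn k X Y φ ∧ IsRegMapOn k Y X ψ ∧
    (∀ a ∈ X, ψ (φ a) = a) ∧ (∀ b ∈ Y, φ (ψ b) = b)

section Helpers

open scoped Matrix TensorProduct

open Equiv in
def capD {S : Type*} [Ring S] {N : ℕ} (y z z' : Fin N → S) : S :=
  ∑ σ : Perm (Fin N), (Perm.sign σ) • (List.ofFn fun i => z i * y (σ i) * z' i).prod

lemma capD_map {S S' : Type*} [Ring S] [Ring S'] {N : ℕ} (f : S →+* S') (y z z' : Fin N → S) :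
    f (capD y z z') = capD (fun i => f (y i)) (fun i => f (z i)) (fun i => f (z' i)) := by
  simp only [capD, map_sum, Units.smul_def, map_zsmul, map_list_prod, List.map_ofFn]
  simp [Function.comp_def]

def capAlt (L : Type*) {S : Type*} [Field L] [Ring S] [Algebra L S] {N : ℕ} (z z' : Fin N → S) :
    S [⋀^Fin N]→ₗ[L] S :=
  MultilinearMap.alternatization ((MultilinearMap.mkPiAlgebraFin L N S).compLinearMap
    (fun i => LinearMap.mulRight L (z' i) ∘ₗ LinearMap.mulLeft L (z i)))

lemma capAlt_apply (L : Type*) {S : Type*} [Field L] [Ring S] [Algebra L S] {N : ℕ}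
    (y z z' : Fin N → S) : capAlt L z z' y = capD y z z' := by
  simp [capAlt, capD, MultilinearMap.alternatization_apply]

lemma capD_update (L : Type*) {S : Type*} [Field L] [Ring S] [Algebra L S] {N : ℕ}
    (y z z' : Fin N → S) (c : Fin N → L) (j : Fin N) :
    capD (Function.update y j (∑ i, c i • y i)) z z' = c j • capD y z z' := by
  rw [← capAlt_apply L, ← capAlt_apply L]
  rw [AlternatingMap.map_update_sum, Finset.sum_eq_single j]
  · rw [AlternatingMap.map_update_smul]; simp
  · intro i _ hij
    rw [AlternatingMap.map_update_smul, AlternatingMap.map_update_self _ _ (Ne.symm hij), smul_zero]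
  · simp

lemma capD_dep (L : Type*) {S : Type*} [Field L] [Ring S] [Algebra L S] {N : ℕ}
    (y z z' : Fin N → S) (h : capD y z z' ≠ 0) : LinearIndependent L y := by
  by_contra hd
  apply h
  rw [← capAlt_apply L]
  exact AlternatingMap.map_linearDependent _ _ hd

lemma capD_ne {n : ℕ} (hn : 1 ≤ n) {K : Type*} [Field K] {N : ℕ} (e : Fin N ≃ Fin n × Fin n)
    (y : Fin N → Matrix (Fin n) (Fin n) K) (hy : LinearIndependent K y) :
    ∃ z z', capD y z z' ≠ 0 := by
  classical
  let r0 : Fin n := ⟨0, hn⟩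
  let Y : Matrix (Fin N) (Fin N) K := Matrix.of fun i j => y j (e i).1 (e i).2
  have hdet : Y.det ≠ 0 := by
    intro h0
    obtain ⟨v, hv, hv0⟩ := Matrix.exists_mulVec_eq_zero_iff.mpr h0
    apply hv
    funext i
    refine Fintype.linearIndependent_iff.mp hy v ?_ i
    ext r c
    have := congrFun hv0 (e.symm (r, c))
    simp [Matrix.mulVec, dotProduct, Y] at this
    simp [Matrix.sum_apply, ← this, mul_comm]
  refine ⟨fun i => Matrix.single r0 (e i).1 1, fun i => Matrix.single (e i).2 r0 1, fun h => hdet ?_⟩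
  have h1 : ∀ σ : Equiv.Perm (Fin N), ((List.ofFn fun i =>
      Matrix.single r0 (e i).1 (1:K) * y (σ i) * Matrix.single (e i).2 r0 1).prod :
      Matrix (Fin n) (Fin n) K) r0 r0
      = ∏ i, Y i (σ i) := by
    intro σ
    have h2 : ∀ i, Matrix.single r0 (e i).1 (1:K) * y (σ i) * Matrix.single (e i).2 r0 1
        = Matrix.single r0 r0 (Y i (σ i)) := by
      intro i
      simp [Y, Matrix.single_mul_mul_single]
    simp only [h2]
    have h3 : ∀ l : List K, (l.map (Matrix.single r0 r0)).prod r0 r0 = l.prod := by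
      intro l
      induction l with
      | nil => simp
      | cons a l ih =>
        simp only [List.map_cons, List.prod_cons, Matrix.single_mul_apply_same, ih]
    have := h3 (List.ofFn fun i => Y i (σ i))
    rw [List.map_ofFn, List.prod_ofFn] at this
    exact this
  have h4 := congrFun (congrFun h r0) r0
  simp only [capD, Matrix.sum_apply, Matrix.smul_apply, h1, Matrix.zero_apply] at h4
  rw [← Matrix.det_transpose, Matrix.det_apply]
  exact h4

lemma skolem {n : ℕ} (hn : 1 ≤ n) {k κ : Type*} [Field k] [Field κ] [Algebra k κ]
    (θ : Matrix (Fin n) (Fin n) k →ₐ[k] Matrix (Fin n) (Fin n) κ) :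
    ∃ h : GL (Fin n) κ, ∀ x, θ x * h.val = h.val * x.map (algebraMap k κ) := by
  classical
  let r0 : Fin n := ⟨0, hn⟩
  let E : Fin n → Fin n → Matrix (Fin n) (Fin n) κ := fun i j => θ (Matrix.single i j 1)
  have hE : ∀ i j l m, E i j * E l m = if j = l then E i m else 0 := by
    intro i j l m
    simp only [E, ← map_mul]
    split_ifs with h
    · subst h; simp
    · rw [Matrix.single_mul_single_of_ne _ _ _ _ h, map_zero]
  have h0 : E r0 r0 ≠ 0 := by
    intro h
    have h1 : (1 : Matrix (Fin n) (Fin n) κ) = 0 := by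
      rw [← map_one θ, ← Matrix.sum_single_one, map_sum]
      refine Finset.sum_eq_zero fun i _ => ?_
      have := hE i r0 r0 i
      have h2 := hE i r0 r0 r0
      rw [h, mul_zero, if_pos rfl] at h2
      rw [← h2, zero_mul, if_pos rfl] at this
      exact this.symm
    have := congrFun (congrFun h1 r0) r0
    simp at this
  obtain ⟨c, hc⟩ : ∃ c, (fun r => E r0 r0 r c) ≠ 0 := by
    by_contra hcon
    push Not at hcon
    apply h0
    ext r c
    exact congrFun (hcon c) r
  let u : Fin n → κ := Pi.single c 1
  have hu : E r0 r0 *ᵥ u ≠ 0 := by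
    simp only [u, Matrix.mulVec_single_one]
    exact hc
  let H : Matrix (Fin n) (Fin n) κ := Matrix.of fun r i => (E i r0 *ᵥ u) r
  have hcol : ∀ i, H.col i = E i r0 *ᵥ u := fun i => rfl
  have hEH : ∀ i j l, E i j *ᵥ (E l r0 *ᵥ u) = if j = l then E i r0 *ᵥ u else 0 := by
    intro i j l
    rw [Matrix.mulVec_mulVec, hE]
    split_ifs <;> simp
  have hunit : IsUnit H := by
    rw [← Matrix.linearIndependent_cols_iff_isUnit, Fintype.linearIndependent_iff]
    intro g hg j
    have h5 : E r0 j *ᵥ (∑ i, g i • H.col i) = 0 := by rw [hg, Matrix.mulVec_zero]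
    rw [Matrix.mulVec_sum] at h5
    simp only [Matrix.mulVec_smul, hcol, hEH] at h5
    simp at h5
    exact h5.resolve_right hu
  refine ⟨hunit.unit, fun x => ?_⟩
  change θ x * H = H * _
  have hx : x = ∑ i, ∑ j, x i j • Matrix.single i j (1:k) := by
    conv_lhs => rw [Matrix.matrix_eq_sum_single x]
    simp
  have hθ : θ x = ∑ i, ∑ j, algebraMap k κ (x i j) • E i j := by
    conv_lhs => rw [hx]
    simp only [map_sum, map_smul, E, algebraMap_smul]
  ext r l
  have h6 : (θ x * H) r l = (θ x *ᵥ (E l r0 *ᵥ u)) r := rfl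
  rw [h6, hθ]
  simp only [Matrix.sum_mulVec, Matrix.smul_mulVec, hEH]
  simp [Matrix.mul_apply, Finset.sum_apply, H, mul_comm, Algebra.smul_def]
lemma mat_prime {n : ℕ} {K : Type*} [Field K] (s s' : Matrix (Fin n) (Fin n) K)
    (h : s ≠ 0) (h' : s' ≠ 0) : ∃ x, s * x * s' ≠ 0 := by
  classical
  obtain ⟨i, j, hij⟩ : ∃ i j, s i j ≠ 0 := by
    by_contra hc; push Not at hc; exact h (by ext i j; simpa using hc i j)
  obtain ⟨l, m, hlm⟩ : ∃ i j, s' i j ≠ 0 := by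
    by_contra hc; push Not at hc; exact h' (by ext i j; simpa using hc i j)
  refine ⟨Matrix.single j l 1, fun h0 => ?_⟩
  have := congrFun (congrFun h0 i) m
  rw [Matrix.mul_apply, Finset.sum_eq_single l] at this
  · simp [hij, hlm] at this
  · intro b _ hb
    rw [Matrix.mul_single_apply_of_ne _ _ _ _ _ hb, zero_mul]
  · simp

/-- The set of pairs `(λ, μ)` such that multiplication by `λ` specializes to multiplication
by `μ`. -/
def specRing {n : ℕ} {k L F : Type*} [Field k] [Field L] [Algebra k L] [Ring F] [Algebra k F]
    (ρA : F →ₐ[k] Matrix (Fin n) (Fin n) L) (ρb : F →ₐ[k] Matrix (Fin n) (Fin n) k)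
    (hsurj : Function.Surjective ρb) (hn : (1 : Matrix (Fin n) (Fin n) k) ≠ 0) :
    Subring (L × k) where
  carrier := {x | ∃ s t, ρb s ≠ 0 ∧ ρA t = x.1 • ρA s ∧ ρb t = x.2 • ρb s}
  mul_mem' := by
    rintro x y ⟨s, t, h1, h2, h3⟩ ⟨s', t', h1', h2', h3'⟩
    obtain ⟨u, hu⟩ := mat_prime _ _ h1 h1'
    obtain ⟨u, rfl⟩ := hsurj u
    refine ⟨s * u * s', t * u * t', by simpa using hu, ?_, ?_⟩
    · simp [h2, h2', smul_smul, mul_comm]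
    · simp [h3, h3', smul_smul, mul_comm]
  one_mem' := ⟨1, 1, by simpa using hn, by simp, by simp⟩
  add_mem' := by
    rintro x y ⟨s, t, h1, h2, h3⟩ ⟨s', t', h1', h2', h3'⟩
    obtain ⟨u, hu⟩ := mat_prime _ _ h1 h1'
    obtain ⟨u, rfl⟩ := hsurj u
    refine ⟨s * u * s', t * u * s' + s * u * t', by simpa using hu, ?_, ?_⟩
    · simp [h2, h2', add_smul]
    · simp [h3, h3', add_smul]
  zero_mem' := ⟨1, 0, by simpa using hn, by simp, by simp⟩
  neg_mem' := by
    rintro x ⟨s, t, h1, h2, h3⟩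
    exact ⟨s, -t, h1, by simp [h2], by simp [h3]⟩

lemma exists_val {n : ℕ} {k L F : Type*} [Field k] [Field L] [Algebra k L] [Ring F] [Algebra k F]
    (ρA : F →ₐ[k] Matrix (Fin n) (Fin n) L) (ρb : F →ₐ[k] Matrix (Fin n) (Fin n) k)
    (hsurj : Function.Surjective ρb) (hn : (1 : Matrix (Fin n) (Fin n) k) ≠ 0)
    (hker : ∀ p, ρA p = 0 → ρb p = 0) :
    ∃ V : ValuationSubring L, ∀ x ∈ specRing ρA ρb hsurj hn,
      x.1 ∈ V ∧ (x.2 = 0 → x.1 ∈ V.nonunits) := by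
  set T := specRing ρA ρb hsurj hn with hT
  let B : Subring L := T.map (RingHom.fst L k)
  let I : Ideal B :=
    { carrier := {x | (x.1, (0:k)) ∈ T}
      add_mem' := fun {x y} hx hy => by
        have := T.add_mem hx hy
        simpa using this
      zero_mem' := T.zero_mem
      smul_mem' := by
        rintro ⟨c, c', hc, rfl⟩ x hx
        have := T.mul_mem hc hx
        have h2 : c' * ((x : L), (0:k)) = (c'.1 * x, 0) := Prod.ext rfl (by simp)
        rw [h2] at this
        exact this }
  have hI : I ≠ ⊤ := by
    rw [Ideal.ne_top_iff_one]
    rintro ⟨s, t, h1, h2, h3⟩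
    have h4 : ρA (t - s) = 0 := by rw [map_sub, h2]; simp
    have h5 := hker _ h4
    rw [map_sub, h3] at h5
    simp at h5
    exact h1 h5
  obtain ⟨V, hV, hV'⟩ := Ideal.image_subset_nonunits_valuationSubring I hI
  refine ⟨V, fun x hx => ⟨hV ⟨x, hx, rfl⟩, fun h0 => hV' ?_⟩⟩
  refine ⟨⟨x.1, x, hx, rfl⟩, ?_, rfl⟩
  change (x.1, (0:k)) ∈ T
  rw [← h0]
  exact hx

lemma lift_surj {k F A B : Type*} [CommRing k] [Ring F] [Ring A] [Ring B] [Algebra k F] [Algebra k A]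
    [Algebra k B] (f : F →ₐ[k] A) (hf : Function.Surjective f) (g : F →ₐ[k] B)
    (hk : ∀ p, f p = 0 → g p = 0) : ∃ θ : A →ₐ[k] B, ∀ p, θ (f p) = g p := by
  have key : ∀ p q, f p = f q → g p = g q := fun p q h => by
    have := hk (p - q) (by rw [map_sub, h, sub_self])
    rwa [map_sub, sub_eq_zero] at this
  have key2 : ∀ p, g (Function.surjInv hf (f p)) = g p := fun p =>
    key _ _ (Function.surjInv_eq hf _)
  refine ⟨AlgHom.ofLinearMap
    { toFun := fun x => g (Function.surjInv hf x)
      map_add' := fun x y => by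
        obtain ⟨x, rfl⟩ := hf x
        obtain ⟨y, rfl⟩ := hf y
        have h := key2 (x + y)
        simp only [map_add] at h
        simp only [key2]
        exact h
      map_smul' := fun c x => by
        obtain ⟨x, rfl⟩ := hf x
        have h := key2 (c • x)
        simp only [map_smul] at h
        simp only [key2]
        exact h } ?_ ?_, fun p => key2 p⟩
  · change g (Function.surjInv hf 1) = 1
    rw [← map_one f, key2, map_one]
  · intro x y
    obtain ⟨x, rfl⟩ := hf x
    obtain ⟨y, rfl⟩ := hf y
    change g (Function.surjInv hf _) = g (Function.surjInv hf _) * g (Function.surjInv hf _)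
    have h := key2 (x * y)
    simp only [map_mul] at h
    simp only [key2]
    exact h

lemma lattice_basis {n : ℕ} {L : Type*} [Field L] (V : ValuationSubring L)
    (Λ : Submodule V (Fin n → L)) (hfg : Λ.FG) (hspan : Submodule.span L (Λ : Set (Fin n → L)) = ⊤) :
    ∃ g : GL (Fin n) L, ∀ v, v ∈ Λ ↔ ∃ x : Fin n → V, v = g.val *ᵥ (fun i => (x i : L)) := by
  classical
  have : Submodule.IsLattice L Λ := ⟨hfg, hspan⟩
  have : Module.Finite V Λ := Module.Finite.iff_fg.mpr hfg
  have : Module.IsTorsionFree V L := inferInstance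
  have : Module.IsTorsionFree V (Fin n → L) := inferInstance
  have : Module.Flat V Λ := by
    rw [Module.Flat.flat_iff_torsion_eq_bot_of_isBezout, ← Submodule.isTorsionFree_iff_torsion_eq_bot]
    infer_instance
  have : Module.Free V Λ := Module.free_of_flat_of_isLocalRing
  let b0 := Module.Free.chooseBasis V Λ
  let e : Module.Free.ChooseBasisIndex V Λ ≃ Fin n :=
    (b0.extendOfIsLattice L).indexEquiv (Pi.basisFun L (Fin n))
  let b := b0.reindex e
  let b' := b.extendOfIsLattice L
  have hb' : ∀ i, b' i = (b i : Fin n → L) := fun i => by simp [b']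
  let G : Matrix (Fin n) (Fin n) L := Matrix.of fun r i => b' i r
  have hG : IsUnit G := by
    rw [← Matrix.linearIndependent_cols_iff_isUnit]
    exact b'.linearIndependent
  have hmul : ∀ x : Fin n → L, G *ᵥ x = ∑ i, x i • b' i := by
    intro x
    ext r
    simp [Matrix.mulVec, dotProduct, G, mul_comm]
  refine ⟨hG.unit, fun v => ?_⟩
  change _ ↔ ∃ x : Fin n → V, v = G *ᵥ _
  simp only [hmul, hb']
  constructor
  · intro hv
    refine ⟨b.repr ⟨v, hv⟩, ?_⟩
    have := congrArg Subtype.val (b.sum_repr ⟨v, hv⟩)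
    simp only [Submodule.coe_sum, Submodule.coe_smul] at this
    exact this.symm
  · rintro ⟨x, rfl⟩
    exact Submodule.sum_mem _ fun i _ => Λ.smul_mem (x i) (b i).2

lemma specialize {n : ℕ} (hn : 1 ≤ n) {k L F : Type*} [Field k] [Field L] [Algebra k L] [Ring F]
    [Algebra k F]
    (ρA : F →ₐ[k] Matrix (Fin n) (Fin n) L) (ρb : F →ₐ[k] Matrix (Fin n) (Fin n) k)
    (hsurj : Function.Surjective ρb) (hker : ∀ p, ρA p = 0 → ρb p = 0) :
    ∃ (V : ValuationSubring L) (hk : ∀ x : k, algebraMap k L x ∈ V) (g : GL (Fin n) L),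
      ∀ p, ∃ M : Matrix (Fin n) (Fin n) V, ρA p * g.val = g.val * M.map V.subtype ∧
        M.map (IsLocalRing.residue V) =
          (ρb p).map (fun x => IsLocalRing.residue V ⟨algebraMap k L x, hk x⟩) := by
  classical
  let r0 : Fin n := ⟨0, hn⟩
  have h1 : (1 : Matrix (Fin n) (Fin n) k) ≠ 0 := by
    intro h
    have := congrFun (congrFun h r0) r0
    simp at this
  let e : Fin (n * n) ≃ Fin n × Fin n := finProdFinEquiv.symm
  let y := (Matrix.stdBasis k (Fin n) (Fin n)).reindex e.symm
  choose w hw using fun i => hsurj (y i)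
  obtain ⟨z, z', hz⟩ := capD_ne hn e y y.linearIndependent
  choose Z hZ using fun i => hsurj (z i)
  choose Z' hZ' using fun i => hsurj (z' i)
  have hDb : ρb (capD w Z Z') ≠ 0 := by
    have := capD_map (ρb : F →+* Matrix (Fin n) (Fin n) k) w Z Z'
    simp only [RingHom.coe_coe, hw, hZ, hZ'] at this
    rw [this]; exact hz
  have hDA : ρA (capD w Z Z') ≠ 0 := fun h => hDb (hker _ h)
  have hDAm := capD_map (ρA : F →+* Matrix (Fin n) (Fin n) L) w Z Z'
  simp only [RingHom.coe_coe] at hDAm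
  have hli : LinearIndependent L (fun i => ρA (w i)) := by
    apply capD_dep L _ (fun i => ρA (Z i)) (fun i => ρA (Z' i))
    rw [← hDAm]; exact hDA
  have : Nonempty (Fin (n * n)) := ⟨e.symm (r0, r0)⟩
  let yA : Module.Basis (Fin (n * n)) L (Matrix (Fin n) (Fin n) L) :=
    basisOfLinearIndependentOfCardEqFinrank hli (by simp [Module.finrank_matrix])
  have hyA : ∀ i, yA i = ρA (w i) := fun i => by simp [yA]
  obtain ⟨V, hV⟩ := exists_val ρA ρb hsurj h1 hker
  have hk2 : ∀ x : k, (algebraMap k L x, x) ∈ specRing ρA ρb hsurj h1 := fun x =>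
    ⟨1, algebraMap k F x, by simpa using h1, by
      simp [Algebra.algebraMap_eq_smul_one], by simp [Algebra.algebraMap_eq_smul_one]⟩
  have hk : ∀ x : k, algebraMap k L x ∈ V := fun x => (hV _ (hk2 x)).1
  have hc : ∀ p j, (yA.repr (ρA p) j, y.repr (ρb p) j) ∈ specRing ρA ρb hsurj h1 := by
    intro p j
    refine ⟨capD w Z Z', capD (Function.update w j p) Z Z', hDb, ?_, ?_⟩
    · have h2 := capD_map (ρA : F →+* Matrix (Fin n) (Fin n) L) (Function.update w j p) Z Z'
      simp only [RingHom.coe_coe] at h2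
      rw [h2, hDAm]
      have h3 : (fun i => ρA (Function.update w j p i)) =
          Function.update (fun i => ρA (w i)) j (∑ i, yA.repr (ρA p) i • ρA (w i)) := by
        have h4 : ∑ i, yA.repr (ρA p) i • ρA (w i) = ρA p := by
          simp only [← hyA]; exact yA.sum_repr _
        rw [h4]
        ext1 i
        by_cases hi : i = j
        · subst hi; simp
        · simp [hi]
      rw [h3, capD_update L]
    · have h2 := capD_map (ρb : F →+* Matrix (Fin n) (Fin n) k) (Function.update w j p) Z Z'
      have h2' := capD_map (ρb : F →+* Matrix (Fin n) (Fin n) k) w Z Z'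
      simp only [RingHom.coe_coe] at h2 h2'
      rw [h2, h2']
      have h3 : (fun i => ρb (Function.update w j p i)) =
          Function.update (fun i => ρb (w i)) j (∑ i, y.repr (ρb p) i • ρb (w i)) := by
        have h4 : ∑ i, y.repr (ρb p) i • ρb (w i) = ρb p := by
          simp only [hw]; exact y.sum_repr _
        rw [h4]
        ext1 i
        by_cases hi : i = j
        · subst hi; simp
        · simp [hi]
      rw [h3, capD_update k]
  have hcV : ∀ p j, yA.repr (ρA p) j ∈ V := fun p j => (hV _ (hc p j)).1
  have hexp : ∀ p, ρA p = ∑ j, yA.repr (ρA p) j • ρA (w j) := fun p => by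
    simp only [← hyA]; exact (yA.sum_repr _).symm
  let v0 : Fin n → L := Pi.single r0 1
  let Λ : Submodule V (Fin n → L) := Submodule.span V (Set.range fun j => ρA (w j) *ᵥ v0)
  have hΛ1 : ∀ p, ρA p *ᵥ v0 ∈ Λ := by
    intro p
    rw [hexp p, Matrix.sum_mulVec]
    refine Submodule.sum_mem _ fun j _ => ?_
    rw [Matrix.smul_mulVec]
    exact Λ.smul_mem (⟨_, hcV p j⟩ : V) (Submodule.subset_span ⟨j, rfl⟩)
  have hΛ2 : ∀ p v, v ∈ Λ → ρA p *ᵥ v ∈ Λ := by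
    intro p v hv
    induction hv using Submodule.span_induction with
    | mem x hx =>
      obtain ⟨j, rfl⟩ := hx
      simp only [Matrix.mulVec_mulVec, ← map_mul]
      exact hΛ1 _
    | zero => simp
    | add x y _ _ hx hy => rw [Matrix.mulVec_add]; exact Λ.add_mem hx hy
    | smul a x _ hx =>
      have : ρA p *ᵥ (a • x) = a • (ρA p *ᵥ x) := Matrix.mulVec_smul (ρA p) (a : L) x
      rw [this]; exact Λ.smul_mem _ hx
  have hspan : Submodule.span L (Λ : Set (Fin n → L)) = ⊤ := by
    rw [eq_top_iff]
    rintro u -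
    let M : Matrix (Fin n) (Fin n) L := Matrix.of fun r _ => u r
    have hM : u = M *ᵥ v0 := by
      ext r; simp [M, v0]
    rw [hM, ← yA.sum_repr M, Matrix.sum_mulVec]
    refine Submodule.sum_mem _ fun j _ => ?_
    rw [Matrix.smul_mulVec, hyA]
    exact Submodule.smul_mem _ _ (Submodule.subset_span (hΛ1 _))
  obtain ⟨g, hg⟩ := lattice_basis V Λ (Submodule.fg_span (Set.finite_range _)) hspan
  have hM : ∀ p, ∃ M : Matrix (Fin n) (Fin n) V, ρA p * g.val = g.val * M.map V.subtype := by
    intro p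
    have h5 : ∀ j, ∃ x : Fin n → V, ρA p *ᵥ (g.val.col j) = g.val *ᵥ fun i => (x i : L) := by
      intro j
      apply (hg _).mp
      apply hΛ2
      refine (hg _).mpr ⟨Pi.single j 1, ?_⟩
      have : (fun i => (((Pi.single j 1 : Fin n → V) i : V) : L)) = Pi.single j 1 := by
        ext i; by_cases hi : i = j
        · subst hi; simp
        · simp [hi]
      rw [this, Matrix.mulVec_single_one]
    choose x hx using h5
    refine ⟨Matrix.of fun i j => x j i, ?_⟩
    ext r j
    exact congrFun (hx j) r
  choose σ hσ using hM
  have hinj : ∀ M M' : Matrix (Fin n) (Fin n) V,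
      g.val * M.map V.subtype = g.val * M'.map V.subtype → M = M' := by
    intro M M' h
    have h6 : M.map V.subtype = M'.map V.subtype := by
      have := congrArg (fun X => (g⁻¹).val * X) h
      simpa [← mul_assoc] using this
    ext i j
    have := congrFun (congrFun h6 i) j
    simpa using this
  let Vs : Matrix (Fin n) (Fin n) V →+* Matrix (Fin n) (Fin n) L := V.subtype.mapMatrix
  have hinj' : ∀ M M' : Matrix (Fin n) (Fin n) V, g.val * Vs M = g.val * Vs M' → M = M' := hinj
  have hσ' : ∀ p, ρA p * g.val = g.val * Vs (σ p) := hσ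
  let ι : k →+* V := (algebraMap k L).codRestrict V.toSubring hk
  let κ := IsLocalRing.ResidueField V
  let _ : Algebra k κ := ((IsLocalRing.residue V).comp ι).toAlgebra
  let σh : F →+* Matrix (Fin n) (Fin n) V :=
    { toFun := σ
      map_one' := hinj' _ _ (by rw [← hσ']; simp)
      map_mul' := fun p q => hinj' _ _ (by
        rw [← hσ', map_mul, map_mul, mul_assoc, hσ' q, ← mul_assoc, hσ' p, mul_assoc])
      map_zero' := hinj' _ _ (by rw [← hσ']; simp)
      map_add' := fun p q => hinj' _ _ (by
        rw [← hσ', map_add, map_add, add_mul, mul_add, hσ', hσ']) }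
  have hsmul : ∀ p, σ p = ∑ j, (⟨_, hcV p j⟩ : V) • σ (w j) := by
    intro p
    apply hinj'
    rw [← hσ', map_sum, Finset.mul_sum]
    conv_lhs => rw [hexp p, Finset.sum_mul]
    refine Finset.sum_congr rfl fun j _ => ?_
    have : Vs ((⟨_, hcV p j⟩ : V) • σ (w j)) = yA.repr (ρA p) j • Vs (σ (w j)) := by
      ext r c; simp [Vs]
    rw [this, Matrix.smul_mul, hσ', Matrix.mul_smul]
  have hcomm : ∀ x : k, σ (algebraMap k F x) = algebraMap V _ (ι x) := by
    intro x
    apply hinj'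
    rw [← hσ']
    have : Vs (algebraMap V _ (ι x)) = algebraMap L _ (algebraMap k L x) := by
      ext r c; by_cases h : r = c <;> simp [Vs, Matrix.algebraMap_matrix_apply, h, ι]
    rw [this, AlgHom.commutes, IsScalarTower.algebraMap_apply k L, Algebra.commutes]
  let σk : F →ₐ[k] Matrix (Fin n) (Fin n) κ :=
    { ((IsLocalRing.residue V).mapMatrix : Matrix (Fin n) (Fin n) V →+* _).comp σh with
      commutes' := fun x => by
        change (IsLocalRing.residue V).mapMatrix (σ _) = _
        rw [hcomm]
        ext r c
        by_cases h : r = c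
        · subst h; simp [Matrix.algebraMap_matrix_apply]; rfl
        · simp [Matrix.algebraMap_matrix_apply, h] }
  have hσk : ∀ p, σk p = (σ p).map (IsLocalRing.residue V) := fun p => rfl
  have hkill : ∀ p, ρb p = 0 → σk p = 0 := by
    intro p hp
    rw [hσk, hsmul p]
    have h7 : ∀ j, IsLocalRing.residue V (⟨_, hcV p j⟩ : V) = 0 := by
      intro j
      rw [IsLocalRing.residue_eq_zero_iff]
      have h8 := (hV _ (hc p j)).2 (by simp [hp])
      rw [← SetLike.mem_coe, ← V.image_maximalIdeal] at h8
      obtain ⟨a, ha, hab⟩ := h8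
      have : a = ⟨_, hcV p j⟩ := Subtype.ext hab
      rw [← this]; exact ha
    ext r c
    simp [Matrix.sum_apply, h7]
  obtain ⟨θ, hθ⟩ := lift_surj ρb hsurj σk hkill
  obtain ⟨h, hh⟩ := skolem hn θ
  -- lift `h` to an invertible matrix over `V`
  choose H hH using fun r c => IsLocalRing.residue_surjective (R := V) (h.val r c)
  let Hm : Matrix (Fin n) (Fin n) V := Matrix.of H
  have hHm : (IsLocalRing.residue V).mapMatrix Hm = h.val := by ext r c; simp [Hm, hH]
  have hHu : IsUnit Hm := by
    rw [Matrix.isUnit_iff_isUnit_det]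
    have h9 : IsUnit (IsLocalRing.residue V Hm.det) := by
      rw [RingHom.map_det, hHm]
      exact (Matrix.isUnit_iff_isUnit_det _).mp h.isUnit
    exact (isUnit_map_iff (IsLocalRing.residue V) _).mp h9
  obtain ⟨Hu, hHu'⟩ := hHu
  refine ⟨V, hk, g * Units.map (Vs : _ →* _) Hu, fun p => ⟨Hu⁻¹.val * σ p * Hu.val, ?_, ?_⟩⟩
  · change ρA p * (g.val * Vs Hu.val) = g.val * Vs Hu.val * Vs _
    rw [← mul_assoc, hσ', mul_assoc, mul_assoc, ← map_mul, ← map_mul, mul_assoc Hu⁻¹.val,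
      Units.mul_inv_cancel_left]
  · change (IsLocalRing.residue V).mapMatrix _ = (ρb p).map (algebraMap k κ)
    have h10 := hh (ρb p)
    rw [hθ, hσk] at h10
    change (IsLocalRing.residue V).mapMatrix (σ p) * _ = _ at h10
    rw [← hHm, ← hHu'] at h10
    rw [map_mul, map_mul, mul_assoc, h10, ← mul_assoc, ← map_mul, Units.inv_mul, map_one, one_mul]

def evL {k L : Type*} [Field k] [Field L] [Algebra k L] {n m : ℕ}
    (A : Fin m → Matrix (Fin n) (Fin n) L) : MvPolynomial (Fin m × Fin n × Fin n) k →ₐ[k] L :=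
  MvPolynomial.aeval fun x => A x.1 x.2.1 x.2.2

def cjL {L : Type*} [Field L] {n m : ℕ} (g : GL (Fin n) L)
    (A : Fin m → Matrix (Fin n) (Fin n) L) : Fin m → Matrix (Fin n) (Fin n) L :=
  fun h => g.val * A h * (g⁻¹).val

lemma cjL_one {L : Type*} [Field L] {n m : ℕ} (A : Fin m → Matrix (Fin n) (Fin n) L) :
    cjL 1 A = A := by
  ext1 h; simp [cjL]

lemma cjL_mul {L : Type*} [Field L] {n m : ℕ} (g h : GL (Fin n) L)
    (A : Fin m → Matrix (Fin n) (Fin n) L) : cjL g (cjL h A) = cjL (g * h) A := by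
  ext1 i; simp [cjL, mul_assoc]

/-- evaluation of the polynomial `H` at `T = g` and the tuple `A` -/
def evH {k L : Type*} [Field k] [Field L] [Algebra k L] {n m : ℕ}
    (T : Matrix (Fin n) (Fin n) L)
    (A : Fin m → Matrix (Fin n) (Fin n) L) :
    MvPolynomial (Fin n × Fin n) (MvPolynomial (Fin m × Fin n × Fin n) k) →+* L :=
  MvPolynomial.eval₂Hom (evL (k := k) A : MvPolynomial (Fin m × Fin n × Fin n) k →+* L)
    (fun x => T x.1 x.2)

lemma hom_conj {k : Type} [Field k] {n m : ℕ} (f : MvPolynomial (Fin m × Fin n × Fin n) k) :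
    ∃ (H : MvPolynomial (Fin n × Fin n) (MvPolynomial (Fin m × Fin n × Fin n) k)) (r : ℕ),
      ∀ (L : Type) [Field L] [Algebra k L] (A : Fin m → Matrix (Fin n) (Fin n) L)
        (g : GL (Fin n) L), evH g.val A H = g.val.det ^ r * evL (cjL g A) f := by
  let S := MvPolynomial (Fin n × Fin n) (MvPolynomial (Fin m × Fin n × Fin n) k)
  let T : Matrix (Fin n) (Fin n) S := Matrix.of fun i j => MvPolynomial.X (i, j)
  let Xg : Fin m → Matrix (Fin n) (Fin n) S := fun h =>
    Matrix.of fun i j => MvPolynomial.C (MvPolynomial.X (h, i, j))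
  have hT : ∀ (L : Type) [Field L] [Algebra k L] (A : Fin m → Matrix (Fin n) (Fin n) L)
      (g : GL (Fin n) L), (evH (k := k) g.val A).mapMatrix T = g.val := by
    intro L _ _ A g; ext i j; simp [evH, T]
  have hX : ∀ (L : Type) [Field L] [Algebra k L] (A : Fin m → Matrix (Fin n) (Fin n) L)
      (g : GL (Fin n) L) h, (evH (k := k) g.val A).mapMatrix (Xg h) = A h := by
    intro L _ _ A g h; ext i j; simp [evH, Xg, evL]
  have hD : ∀ (L : Type) [Field L] [Algebra k L] (A : Fin m → Matrix (Fin n) (Fin n) L)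
      (g : GL (Fin n) L), evH (k := k) g.val A T.det = g.val.det := by
    intro L _ _ A g; rw [RingHom.map_det, hT]
  have hY : ∀ (L : Type) [Field L] [Algebra k L] (A : Fin m → Matrix (Fin n) (Fin n) L)
      (g : GL (Fin n) L) h i j, evH (k := k) g.val A ((T * Xg h * T.adjugate) i j) =
        g.val.det * cjL g A h i j := by
    intro L _ _ A g h i j
    have h1 : evH (k := k) g.val A ((T * Xg h * T.adjugate) i j) =
      ((evH (k := k) g.val A).mapMatrix (T * Xg h * T.adjugate)) i j := rfl
    rw [h1, map_mul, map_mul, hT, hX, RingHom.map_adjugate, hT]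
    have h2 : g.val.adjugate = g.val.det • (g⁻¹).val := by
      have h3 : g.val.adjugate = g.val.adjugate * g.val * (g⁻¹).val := by
        rw [mul_assoc]; simp
      rw [h3, Matrix.adjugate_mul]; simp
    rw [h2, Matrix.mul_smul]; simp [cjL]
  induction f using MvPolynomial.induction_on with
  | C c =>
    refine ⟨MvPolynomial.C (MvPolynomial.C c), 0, ?_⟩
    intro L _ _ A g
    simp [evH, evL]
  | add p q hp hq =>
    obtain ⟨H1, r1, h1⟩ := hp
    obtain ⟨H2, r2, h2⟩ := hq
    refine ⟨H1 * T.det ^ r2 + H2 * T.det ^ r1, r1 + r2, ?_⟩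
    intro L _ _ A g
    rw [map_add, map_mul, map_mul, map_pow, map_pow, hD, h1, h2, map_add]
    ring
  | mul_X p x hp =>
    obtain ⟨H1, r1, h1⟩ := hp
    refine ⟨H1 * (T * Xg x.1 * T.adjugate) x.2.1 x.2.2, r1 + 1, ?_⟩
    intro L _ _ A g
    rw [map_mul, hY, h1, map_mul]
    have : evL (k := k) (cjL g A) (MvPolynomial.X x) = cjL g A x.1 x.2.1 x.2.2 := by simp [evL]
    rw [this]; ring

lemma poly_zero_of_GL {L : Type*} [Field L] [Infinite L] {n : ℕ}
    (Q : MvPolynomial (Fin n × Fin n) L)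
    (hQ : ∀ g : GL (Fin n) L, MvPolynomial.eval (fun x => g.val x.1 x.2) Q = 0) : Q = 0 := by
  have h1 : Q * (Matrix.mvPolynomialX (Fin n) (Fin n) L).det = 0 := by
    apply MvPolynomial.funext
    intro v
    rw [map_mul, map_zero]
    let M : Matrix (Fin n) (Fin n) L := Matrix.of fun i j => v (i, j)
    have h2 : MvPolynomial.eval v (Matrix.mvPolynomialX (Fin n) (Fin n) L).det = M.det := by
      rw [RingHom.map_det]
      congr 1
      ext i j; simp [M]
    rw [h2]
    by_cases h : M.det = 0
    · rw [h, mul_zero]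
    · have := hQ (Matrix.GeneralLinearGroup.mkOfDetNeZero M h)
      have h3 : (fun x : Fin n × Fin n =>
        (Matrix.GeneralLinearGroup.mkOfDetNeZero M h).val x.1 x.2) = v := by
        ext x; rfl
      rw [h3] at this
      rw [this, zero_mul]
  rcases mul_eq_zero.mp h1 with h | h
  · exact h
  · exact absurd h (Matrix.det_mvPolynomialX_ne_zero _ _)

lemma evH_eq {k L : Type*} [Field k] [Field L] [Algebra k L] {n m : ℕ}
    (T : Matrix (Fin n) (Fin n) L)
    (A : Fin m → Matrix (Fin n) (Fin n) L)
    (H : MvPolynomial (Fin n × Fin n) (MvPolynomial (Fin m × Fin n × Fin n) k)) :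
    evH T A H = MvPolynomial.eval (fun x => T x.1 x.2)
      (MvPolynomial.map (evL (k := k) A : MvPolynomial (Fin m × Fin n × Fin n) k →+* L) H) := by
  simp [evH, MvPolynomial.eval_map]

lemma conj_prime {k L : Type} [Field k] [Field L] [Infinite L] [Algebra k L] {n m : ℕ}
    (A : Fin m → Matrix (Fin n) (Fin n) L) (f f' : MvPolynomial (Fin m × Fin n × Fin n) k)
    (h : ∀ g : GL (Fin n) L, evL (cjL g A) (f * f') = 0) :
    (∀ g : GL (Fin n) L, evL (cjL g A) f = 0) ∨ (∀ g : GL (Fin n) L, evL (cjL g A) f' = 0) := by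
  obtain ⟨H, r, hH⟩ := hom_conj f
  obtain ⟨H', r', hH'⟩ := hom_conj f'
  have key : ∀ (q : MvPolynomial (Fin m × Fin n × Fin n) k) K s, (∀ g : GL (Fin n) L,
      evH g.val A K = g.val.det ^ s * evL (cjL g A) q) →
      MvPolynomial.map (evL (k := k) A : MvPolynomial (Fin m × Fin n × Fin n) k →+* L) K = 0 →
      ∀ g : GL (Fin n) L, evL (cjL g A) q = 0 := by
    intro q K s hK h0 g
    have h1 := hK g
    rw [evH_eq, h0, map_zero] at h1
    have hdet : g.val.det ≠ 0 := ((Matrix.isUnit_iff_isUnit_det _).mp g.isUnit).ne_zero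
    rcases mul_eq_zero.mp h1.symm with h2 | h2
    · exact absurd h2 (pow_ne_zero _ hdet)
    · exact h2
  have h3 : MvPolynomial.map (evL (k := k) A : MvPolynomial (Fin m × Fin n × Fin n) k →+* L) (H * H') = 0 := by
    apply poly_zero_of_GL
    intro g
    rw [← evH_eq, map_mul, hH L A g, hH' L A g]
    have := h g
    rw [map_mul] at this
    linear_combination (g.val.det ^ r * g.val.det ^ r') * this
  rw [map_mul] at h3
  rcases mul_eq_zero.mp h3 with h4 | h4
  · exact Or.inl (key f H r (hH L A) h4)
  · exact Or.inr (key f' H' r' (hH' L A) h4)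

lemma eval_lift {k : Type} [Field k] [IsAlgClosed k] [CharZero k] {n m : ℕ} (a : MTuple k n m)
    (p : FreeAlgebra k (Fin m)) :
    evalMat k a (FreeAlgebra.lift k (genericMatrix k n m) p) = FreeAlgebra.lift k a p := by
  have : (evalMat k a).comp (FreeAlgebra.lift k (genericMatrix k n m)) = FreeAlgebra.lift k a := by
    apply FreeAlgebra.hom_ext
    ext1 h
    simp only [Function.comp_apply, AlgHom.comp_apply, FreeAlgebra.lift_ι_apply]
    ext i j
    simp [evalMat, polyEval, genericMatrix]
  rw [← this]; rfl

lemma mem_GMN_iff {k : Type} [Field k] [IsAlgClosed k] [CharZero k] {n m : ℕ}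
    (F : MatPoly k n m) :
    F ∈ GMN k n m ↔ ∃ p, FreeAlgebra.lift k (genericMatrix k n m) p = F := by
  rw [GMN, Algebra.adjoin_range_eq_range_freeAlgebra_lift]
  rfl

lemma mem_genTuples_iff {k : Type} [Field k] [IsAlgClosed k] [CharZero k] {n m : ℕ}
    (a : MTuple k n m) :
    a ∈ genTuples k n m ↔ Function.Surjective (FreeAlgebra.lift k a) := by
  rw [genTuples, Set.mem_ofPred_eq, Algebra.adjoin_range_eq_range_freeAlgebra_lift,
    AlgHom.range_eq_top]

lemma evL_lift {k L : Type} [Field k] [IsAlgClosed k] [CharZero k] [Field L] [Algebra k L]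
    {n m : ℕ} (A : Fin m → Matrix (Fin n) (Fin n) L) (p : FreeAlgebra k (Fin m)) :
    FreeAlgebra.lift k A p =
      (evL (k := k) A).mapMatrix (FreeAlgebra.lift k (genericMatrix k n m) p) := by
  have : ((evL (k := k) A).mapMatrix).comp (FreeAlgebra.lift k (genericMatrix k n m)) =
      FreeAlgebra.lift k A := by
    apply FreeAlgebra.hom_ext
    ext1 h
    simp only [Function.comp_apply, AlgHom.comp_apply, FreeAlgebra.lift_ι_apply]
    ext i j
    simp [evL, genericMatrix]
  rw [← this]; rfl

def vanP {k : Type} [Field k] [IsAlgClosed k] [CharZero k] {n m : ℕ} (X : Set (MTuple k n m)) :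
    Ideal (PolyRing k n m) where
  carrier := {f | ∀ a ∈ X, polyEval k a f = 0}
  add_mem' := fun hf hg a ha => by rw [map_add, hf a ha, hg a ha, add_zero]
  zero_mem' := fun a _ => map_zero _
  smul_mem' := fun c f hf a ha => by rw [smul_eq_mul, map_mul, hf a ha, mul_zero]

lemma vanP_prime {k : Type} [Field k] [IsAlgClosed k] [CharZero k] {n m : ℕ}
    (X : Set (MTuple k n m)) (hX : IsIrredSubset k X) : (vanP X).IsPrime := by
  constructor
  · intro h
    obtain ⟨a, ha⟩ := hX.1
    have : (1 : PolyRing k n m) ∈ vanP X := by rw [h]; trivial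
    have := this a ha
    simp at this
  · intro f f' hf
    have := hX.2 {a | ∀ p ∈ ({f} : Set (PolyRing k n m)), polyEval k a p = 0}
      {a | ∀ p ∈ ({f'} : Set (PolyRing k n m)), polyEval k a p = 0} ⟨_, rfl⟩ ⟨_, rfl⟩
      (fun a ha => by
        have h1 := hf a ha
        rw [map_mul] at h1
        rcases mul_eq_zero.mp h1 with h | h
        · left; simpa using h
        · right; simpa using h)
    rcases this with h | h
    · left; intro a ha; exact h ha f rfl
    · right; intro a ha; exact h ha f' rfl

lemma crux {k : Type} [Field k] [IsAlgClosed k] [CharZero k] {n m : ℕ} (hn : 1 ≤ n)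
    (X : Set (MTuple k n m)) (hV : IsNVariety k X) (hX : IsIrredSubset k X)
    (b : MTuple k n m) (hb : b ∈ genTuples k n m)
    (hker : ∀ p : FreeAlgebra k (Fin m), (∀ a ∈ X, FreeAlgebra.lift k a p = 0) →
      FreeAlgebra.lift k b p = 0) : b ∈ X := by
  have hP := vanP_prime X hX
  let D := PolyRing k n m ⧸ vanP X
  let L := FractionRing D
  let A : Fin m → Matrix (Fin n) (Fin n) L := fun h => Matrix.of fun i j =>
    algebraMap D L (Ideal.Quotient.mk (vanP X) (MvPolynomial.X (h, i, j)))
  have hA : ∀ f, evL (k := k) A f = algebraMap D L (Ideal.Quotient.mk (vanP X) f) := by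
    have : evL (k := k) A = ((IsScalarTower.toAlgHom k D L).comp (Ideal.Quotient.mkₐ k (vanP X))) := by
      apply MvPolynomial.algHom_ext
      intro x
      simp [evL, A]
      rfl
    intro f
    rw [this]; rfl
  have hA0 : ∀ f, evL (k := k) A f = 0 ↔ f ∈ vanP X := by
    intro f
    rw [hA, FaithfulSMul.algebraMap_eq_zero_iff, Ideal.Quotient.eq_zero_iff_mem]
  have hconj : ∀ f ∈ vanP X, ∀ g : GL (Fin n) L, evL (cjL g A) f = 0 := by
    intro f hf g
    obtain ⟨H, r, hH⟩ := hom_conj f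
    have h1 : ∀ a ∈ X, MvPolynomial.map (evL (k := k) a : PolyRing k n m →+* k) H = 0 := by
      intro a ha
      apply poly_zero_of_GL
      intro t
      rw [← evH_eq, hH k a t]
      have h2 : evL (k := k) (cjL t a) f = 0 := hf _ (hV.2.1 t a ha)
      rw [h2, mul_zero]
    have h3 : MvPolynomial.map (evL (k := k) A : PolyRing k n m →+* L) H = 0 := by
      ext d
      rw [MvPolynomial.coeff_map, MvPolynomial.coeff_zero]
      apply (hA0 _).mpr
      intro a ha
      have := congrArg (MvPolynomial.coeff d) (h1 a ha)
      rw [MvPolynomial.coeff_map] at this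
      exact this
    have h4 := hH L A g
    rw [evH_eq, h3, map_zero] at h4
    have hdet : g.val.det ≠ 0 := ((Matrix.isUnit_iff_isUnit_det _).mp g.isUnit).ne_zero
    rcases mul_eq_zero.mp h4.symm with h2 | h2
    · exact absurd h2 (pow_ne_zero _ hdet)
    · exact h2
  obtain ⟨V, hk, g, hg⟩ := specialize hn (FreeAlgebra.lift k A) (FreeAlgebra.lift k b)
    ((mem_genTuples_iff b).mp hb) (by
      intro p hp
      apply hker
      intro a ha
      rw [evL_lift] at hp
      rw [← eval_lift]
      ext i j
      have := congrFun (congrFun hp i) j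
      exact (hA0 _).mp this a ha)
  choose M hM1 hM2 using fun h => hg (FreeAlgebra.ι k h)
  simp only [FreeAlgebra.lift_ι_apply] at hM1 hM2
  have hcj : cjL g⁻¹ A = fun h => (M h).map V.subtype := by
    ext1 h
    rw [cjL, mul_assoc, inv_inv, hM1, ← mul_assoc]
    simp
  let ι : k →+* V := (algebraMap k L).codRestrict V.toSubring hk
  let e : PolyRing k n m →+* V := MvPolynomial.eval₂Hom ι (fun x => M x.1 x.2.1 x.2.2)
  have he1 : ∀ f, (e f : L) = evL (cjL g⁻¹ A) f := by
    have : V.subtype.comp e = (evL (k := k) (cjL g⁻¹ A) : PolyRing k n m →+* L) := by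
      apply MvPolynomial.ringHom_ext
      · intro c; simp [e, evL, ι]
      · intro x; simp [e, evL, hcj]
    intro f
    exact congrArg (fun q : PolyRing k n m →+* L => q f) this
  have he2 : ∀ f, IsLocalRing.residue V (e f) = IsLocalRing.residue V (ι (polyEval k b f)) := by
    have : (IsLocalRing.residue V).comp e =
        ((IsLocalRing.residue V).comp ι).comp (polyEval k b : PolyRing k n m →+* k) := by
      apply MvPolynomial.ringHom_ext
      · intro c; simp [e, polyEval]
      · intro x
        have := congrFun (congrFun (hM2 x.1) x.2.1) x.2.2
        simp only [Matrix.map_apply] at this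
        simp [e, polyEval, this]
        rfl
    intro f
    exact congrArg (fun q : PolyRing k n m →+* _ => q f) this
  have hfin : ∀ f ∈ vanP X, polyEval k b f = 0 := by
    intro f hf
    have h1 : e f = 0 := by
      apply Subtype.ext
      rw [he1, hconj f hf]; rfl
    have h2 := he2 f
    rw [h1, map_zero] at h2
    exact (map_eq_zero ((IsLocalRing.residue V).comp ι)).mp h2.symm
  obtain ⟨C, ⟨S, rfl⟩, hC⟩ := hV.2.2
  rw [hC]
  refine ⟨fun p hp => hfin p fun a ha => ?_, hb⟩
  rw [hC] at ha
  exact ha.1 p hp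

/-- the canonical surjection from the free algebra to the coordinate ring -/
lemma coord_surj {k : Type} [Field k] [IsAlgClosed k] [CharZero k] {n m : ℕ}
    (X : Set (MTuple k n m)) :
    ∃ π : FreeAlgebra k (Fin m) →ₐ[k] ↥(coordRing k X), Function.Surjective π ∧
      ∀ p (a : X), (π p : X → Matrix (Fin n) (Fin n) k) a = FreeAlgebra.lift k a.val p := by
  let π0 := (restrictTo k X).comp (FreeAlgebra.lift k (genericMatrix k n m))
  have h0 : ∀ p, π0 p ∈ coordRing k X := fun p =>
    ⟨_, (mem_GMN_iff _).mpr ⟨p, rfl⟩, rfl⟩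
  refine ⟨π0.codRestrict _ h0, ?_, ?_⟩
  · rintro ⟨_, F, hF, rfl⟩
    obtain ⟨p, rfl⟩ := (mem_GMN_iff F).mp hF
    exact ⟨p, rfl⟩
  · intro p a
    exact eval_lift a.val p

/-- half of the uniqueness: the regular map attached to an isomorphism of coordinate rings -/
lemma reg_of_iso {k : Type} [Field k] [IsAlgClosed k] [CharZero k] {n m l : ℕ} (hn : 1 ≤ n)
    (X : Set (MTuple k n m)) (Y : Set (MTuple k n l)) (hX : IsNVariety k X)
    (hY : IsNVariety k Y) (hYi : IsIrredSubset k Y)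
    (πX : FreeAlgebra k (Fin m) →ₐ[k] ↥(coordRing k X))
    (hπX : Function.Surjective πX)
    (hπX' : ∀ p (a : X), (πX p : X → Matrix (Fin n) (Fin n) k) a = FreeAlgebra.lift k a.val p)
    (πY : FreeAlgebra k (Fin l) →ₐ[k] ↥(coordRing k Y))
    (hπY : Function.Surjective πY)
    (hπY' : ∀ p (a : Y), (πY p : Y → Matrix (Fin n) (Fin n) k) a = FreeAlgebra.lift k a.val p)
    (α : ↥(coordRing k Y) ≃ₐ[k] ↥(coordRing k X)) :
    ∃ φ : MTuple k n m → MTuple k n l, IsRegMapOn k X Y φ ∧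
      ∀ (a : X) p, FreeAlgebra.lift k (φ a) p = (α (πY p) : X → Matrix (Fin n) (Fin n) k) a := by
  choose q hq using fun i => hπX (α (πY (FreeAlgebra.ι k i)))
  let φ : MTuple k n m → MTuple k n l := fun a i => FreeAlgebra.lift k a (q i)
  have h1 : ∀ (a : X) p, FreeAlgebra.lift k (φ a) p =
      (α (πY p) : X → Matrix (Fin n) (Fin n) k) a := by
    intro a p
    let ev : ↥(coordRing k X) →ₐ[k] Matrix (Fin n) (Fin n) k :=
      (Pi.evalAlgHom k _ a).comp (coordRing k X).val
    have : FreeAlgebra.lift k (φ a) = (ev.comp α.toAlgHom).comp πY := by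
      apply FreeAlgebra.hom_ext
      ext1 i
      simp only [Function.comp_apply, FreeAlgebra.lift_ι_apply]
      change FreeAlgebra.lift k a.val (q i) =
        (α (πY (FreeAlgebra.ι k i)) : X → Matrix (Fin n) (Fin n) k) a
      rw [← hq, hπX']
    rw [this]; rfl
  refine ⟨φ, ⟨fun a ha => ?_, fun i => FreeAlgebra.lift k (genericMatrix k n m) (q i), 
    fun i => (mem_GMN_iff _).mpr ⟨_, rfl⟩, fun a ha i => (eval_lift a (q i)).symm⟩, h1⟩
  apply crux hn Y hY hYi
  · rw [mem_genTuples_iff]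
    intro x
    obtain ⟨p, hp⟩ := (mem_genTuples_iff a).mp (hX.1 ha) x
    obtain ⟨p', hp'⟩ := hπY (α.symm (πX p))
    refine ⟨p', ?_⟩
    rw [h1 ⟨a, ha⟩, hp', AlgEquiv.apply_symm_apply, hπX', hp]
  · intro p hp
    rw [h1 ⟨a, ha⟩]
    have : πY p = 0 := by
      apply Subtype.ext
      ext1 b
      rw [hπY']
      exact hp b.val b.2
    rw [this, map_zero]; rfl

lemma uniq {k : Type} [Field k] [IsAlgClosed k] [CharZero k] {n m l : ℕ} (hn : 1 ≤ n)
    (X : Set (MTuple k n m)) (Y : Set (MTuple k n l)) (hX : IsNVariety k X)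
    (hXi : IsIrredSubset k X)
    (hY : IsNVariety k Y) (hYi : IsIrredSubset k Y)
    (α : ↥(coordRing k Y) ≃ₐ[k] ↥(coordRing k X)) : NIsomorphic k X Y := by
  obtain ⟨πX, hπX, hπX'⟩ := coord_surj X
  obtain ⟨πY, hπY, hπY'⟩ := coord_surj Y
  obtain ⟨φ, hφ, hφ'⟩ := reg_of_iso hn X Y hX hY hYi πX hπX hπX' πY hπY hπY' α
  obtain ⟨ψ, hψ, hψ'⟩ := reg_of_iso hn Y X hY hX hXi πY hπY hπY' πX hπX hπX' α.symm
  refine ⟨φ, ψ, hφ, hψ, fun a ha => ?_, fun b hb => ?_⟩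
  · ext1 i
    have h1 := hψ' ⟨φ a, hφ.1 a ha⟩ (FreeAlgebra.ι k i)
    rw [FreeAlgebra.lift_ι_apply] at h1
    rw [h1]
    obtain ⟨p, hp⟩ := hπY (α.symm (πX (FreeAlgebra.ι k i)))
    rw [← hp, hπY', hφ' ⟨a, ha⟩, hp, AlgEquiv.apply_symm_apply, hπX', FreeAlgebra.lift_ι_apply]
  · ext1 i
    have h1 := hφ' ⟨ψ b, hψ.1 b hb⟩ (FreeAlgebra.ι k i)
    rw [FreeAlgebra.lift_ι_apply] at h1
    rw [h1]
    obtain ⟨p, hp⟩ := hπX (α (πY (FreeAlgebra.ι k i)))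
    rw [← hp, hπX', hψ' ⟨b, hb⟩, hp, AlgEquiv.symm_apply_apply, hπY', FreeAlgebra.lift_ι_apply]

lemma simple_tensor {K L Q : Type*} [Field K] [Field L] [Algebra K L] [Ring Q] [Algebra K Q]
    [IsSimpleRing Q] (hc : ∀ z : Q, (∀ q, q * z = z * q) → ∃ c : K, algebraMap K Q c = z) :
    IsSimpleRing (L ⊗[K] Q) := by
  classical
  let ℬ := Module.Basis.ofVectorSpace K L
  let ε := TensorProduct.equivFinsuppOfBasisLeft (N := Q) ℬ
  have hl : ∀ q (x : L ⊗[K] Q) i, ε ((1 ⊗ₜ q) * x) i = q * ε x i := by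
    intro q x i
    induction x with
    | zero => simp
    | tmul a b => simp [ε, Algebra.TensorProduct.tmul_mul_tmul]
    | add x y hx hy => rw [mul_add, map_add, map_add, Finsupp.add_apply, Finsupp.add_apply, hx, hy,
        mul_add]
  have hr : ∀ q (x : L ⊗[K] Q) i, ε (x * (1 ⊗ₜ q)) i = ε x i * q := by
    intro q x i
    induction x with
    | zero => simp
    | tmul a b => simp [ε, Algebra.TensorProduct.tmul_mul_tmul]
    | add x y hx hy => rw [add_mul, map_add, map_add, Finsupp.add_apply, Finsupp.add_apply, hx, hy,
        add_mul]
  have hnt : Nontrivial (L ⊗[K] Q) := inferInstance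
  apply IsSimpleRing.of_eq_bot_or_eq_top
  intro I
  by_contra! hI
  obtain ⟨hI1, hI2⟩ := hI
  have hex : ∃ N : ℕ, ∃ x ∈ I, x ≠ 0 ∧ (ε x).support.card = N := by
    obtain ⟨x, hx1, hx2 : x ≠ 0⟩ := SetLike.exists_of_lt (bot_lt_iff_ne_bot.mpr hI1 : ⊥ < I)
    exact ⟨_, x, hx1, hx2, rfl⟩
  obtain ⟨x, hxI, hx0, hxN⟩ := Nat.find_spec hex
  have hmin : ∀ z ∈ I, (ε z).support ⊂ (ε x).support → z = 0 := by
    intro z hz hs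
    by_contra h0
    have := Finset.card_lt_card hs
    rw [hxN] at this
    exact Nat.find_min hex this ⟨z, hz, h0, rfl⟩
  have hεx : ε x ≠ 0 := fun h => hx0 (by simpa using h)
  obtain ⟨i0, hi0⟩ := Finsupp.support_nonempty_iff.mpr hεx
  let J : TwoSidedIdeal Q := TwoSidedIdeal.mk'
    {q | ∃ y ∈ I, (∀ i, ε x i = 0 → ε y i = 0) ∧ ε y i0 = q}
    ⟨0, I.zero_mem, by simp, by simp⟩
    (by
      rintro _ _ ⟨y, hy, hy1, rfl⟩ ⟨y', hy', hy1', rfl⟩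
      exact ⟨y + y', I.add_mem hy hy', fun i hi => by simp [hy1 i hi, hy1' i hi], by simp⟩)
    (by
      rintro _ ⟨y, hy, hy1, rfl⟩
      exact ⟨-y, I.neg_mem hy, fun i hi => by simp [hy1 i hi], by simp⟩)
    (by
      rintro q _ ⟨y, hy, hy1, rfl⟩
      exact ⟨(1 ⊗ₜ q) * y, I.mul_mem_left _ _ hy, fun i hi => by rw [hl, hy1 i hi, mul_zero],
        hl _ _ _⟩)
    (by
      rintro _ q ⟨y, hy, hy1, rfl⟩
      exact ⟨y * (1 ⊗ₜ q), I.mul_mem_right _ _ hy, fun i hi => by rw [hr, hy1 i hi, zero_mul],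
        hr _ _ _⟩)
  have hJ : (1 : Q) ∈ J := IsSimpleRing.one_mem_of_ne_zero_mem J
    (Finsupp.mem_support_iff.mp hi0) (by
      rw [TwoSidedIdeal.mem_mk']; exact ⟨x, hxI, fun _ h => h, rfl⟩)
  rw [TwoSidedIdeal.mem_mk'] at hJ
  obtain ⟨y, hyI, hy1, hy2⟩ := hJ
  have hcomm : ∀ q, (1 ⊗ₜ q) * y = y * (1 ⊗ₜ q) := by
    intro q
    rw [← sub_eq_zero]
    apply hmin _ (I.sub_mem (I.mul_mem_left _ _ hyI) (I.mul_mem_right _ _ hyI))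
    rw [Finset.ssubset_iff_of_subset]
    · refine ⟨i0, hi0, ?_⟩
      rw [Finsupp.notMem_support_iff, map_sub, Finsupp.sub_apply, hl, hr, hy2]
      simp
    · intro i hi
      rw [Finsupp.mem_support_iff] at hi ⊢
      intro h
      apply hi
      rw [map_sub, Finsupp.sub_apply, hl, hr, hy1 i h]
      simp
  have hcen : ∀ i, ∃ c : K, algebraMap K Q c = ε y i := by
    intro i
    apply hc
    intro q
    rw [← hl, ← hr, hcomm]
  choose c hc' using hcen
  let l : L := ∑ i ∈ (ε y).support, c i • ℬ i
  have hy : y = l ⊗ₜ 1 := by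
    have : y = ε.symm (ε y) := by simp
    rw [this, TensorProduct.equivFinsuppOfBasisLeft_symm_apply, Finsupp.sum, TensorProduct.sum_tmul]
    refine Finset.sum_congr rfl fun i _ => ?_
    rw [← hc', Algebra.algebraMap_eq_smul_one, TensorProduct.smul_tmul]
  have hl0 : l ≠ 0 := by
    rintro h
    rw [h, TensorProduct.zero_tmul] at hy
    rw [hy] at hy2
    simp at hy2
  apply hI2
  rw [← TwoSidedIdeal.one_mem_iff]
  have : (l⁻¹ ⊗ₜ 1) * y = 1 := by
    rw [hy, Algebra.TensorProduct.tmul_mul_tmul, inv_mul_cancel₀ hl0, mul_one]; rfl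
  rw [← this]
  exact I.mul_mem_left _ _ hyI

lemma split_csa {K L Q : Type*} [Field K] [Field L] [Algebra K L] [IsAlgClosed L]
    [Ring Q] [Algebra K Q]
    [IsSimpleRing Q] (hc : (algebraMap K Q).range = Subring.center Q) {n : ℕ} (hn : 1 ≤ n)
    (hfin : Module.finrank K Q = n ^ 2) :
    ∃ σ : Q →ₐ[K] Matrix (Fin n) (Fin n) L, Function.Injective σ ∧
      Submodule.span L (Set.range σ) = ⊤ := by
  have hs : IsSimpleRing (L ⊗[K] Q) := simple_tensor (fun z hz => by
    have : z ∈ Subring.center Q := Subring.mem_center_iff.mpr hz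
    rw [← hc] at this
    exact this)
  have : FiniteDimensional K Q := Module.finite_of_finrank_pos (by rw [hfin]; positivity)
  obtain ⟨n', _, ⟨e⟩⟩ := IsSimpleRing.exists_algEquiv_matrix_of_isAlgClosed L (L ⊗[K] Q)
  have hd := e.toLinearEquiv.finrank_eq
  rw [Module.finrank_baseChange, hfin, Module.finrank_matrix] at hd
  simp at hd
  have hnn : n' = n := by nlinarith
  subst hnn
  let σ : Q →ₐ[K] Matrix (Fin n') (Fin n') L :=
    (e.toAlgHom.restrictScalars K).comp Algebra.TensorProduct.includeRight
  refine ⟨σ, RingHom.injective σ.toRingHom, ?_⟩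
  rw [eq_top_iff]
  rintro M -
  obtain ⟨x, rfl⟩ := e.surjective M
  induction x with
  | zero => simp
  | tmul a b =>
    have : e (a ⊗ₜ b) = a • σ b := by
      have h2 : a ⊗ₜ[K] b = a • (1 ⊗ₜ[K] b) := by simp [TensorProduct.smul_tmul']
      rw [h2, map_smul]; rfl
    rw [this]
    exact Submodule.smul_mem _ _ (Submodule.subset_span ⟨b, rfl⟩)
  | add x y hx hy => rw [map_add]; exact Submodule.add_mem _ hx hy

lemma embed_ring {k R : Type} [Field k] [Ring R] [Algebra k R] {n : ℕ} (hn : 1 ≤ n)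
    (hdeg : HasPIDegree n R) :
    ∃ (L : Type) (_ : Field L) (_ : IsAlgClosed L) (_ : Algebra k L)
      (ρ : R →ₐ[k] Matrix (Fin n) (Fin n) L), Function.Injective ρ ∧
      Submodule.span L (Set.range ρ) = ⊤ := by
  obtain ⟨Q, _, f, hf, hu, hq, hsimp, K, _, _, hc, hfin⟩ := hdeg
  have hcen : ∀ z ∈ Subring.center R, ∃ x : K, algebraMap K Q x = f z := by
    intro z hz
    have : f z ∈ Subring.center Q := by
      rw [Subring.mem_center_iff]
      intro q
      obtain ⟨r, d, hd, hd0, hqd⟩ := hq q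
      rw [Subring.mem_center_iff] at hz hd
      apply (hu d (Subring.mem_center_iff.mpr hd) hd0).mul_right_cancel
      rw [mul_assoc, mul_assoc]
      calc q * (f z * f d) = q * f d * f z := by rw [← map_mul, hd z, map_mul, mul_assoc]
        _ = f (r * z) := by rw [hqd, map_mul]
        _ = f z * (q * f d) := by rw [hz r, hqd, map_mul]
    rw [← hc] at this
    exact this
  have hinj : Function.Injective (algebraMap K Q) := FaithfulSMul.algebraMap_injective K Q
  choose j hj using fun c : k => hcen (algebraMap k R c)
    (Subring.mem_center_iff.mpr fun r => (Algebra.commutes c r).symm)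
  let jk : k →+* K :=
    { toFun := j
      map_one' := hinj (by rw [hj]; simp)
      map_mul' := fun x y => hinj (by rw [map_mul, hj, hj, hj]; simp)
      map_zero' := hinj (by rw [hj]; simp)
      map_add' := fun x y => hinj (by rw [map_add, hj, hj, hj]; simp) }
  let L := AlgebraicClosure K
  let _ : Algebra k L := ((algebraMap K L).comp jk).toAlgebra
  obtain ⟨σ, hσ, hspan⟩ := split_csa (L := L) hc hn hfin
  let ρ : R →ₐ[k] Matrix (Fin n) (Fin n) L :=
    { (σ : Q →+* Matrix (Fin n) (Fin n) L).comp f with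
      commutes' := fun c => by
        change σ (f (algebraMap k R c)) = _
        rw [← hj, AlgHom.commutes]
        rfl }
  refine ⟨L, inferInstance, inferInstance, inferInstance, ρ, fun x y h => hf (hσ h), ?_⟩
  rw [eq_top_iff, ← hspan, Submodule.span_le]
  rintro _ ⟨q, rfl⟩
  obtain ⟨r, d, hd, hd0, hqd⟩ := hq q
  obtain ⟨x, hx⟩ := hcen d hd
  have hx0 : x ≠ 0 := by
    rintro rfl
    rw [map_zero] at hx
    exact hd0 (hf (by rw [← hx, map_zero]))
  have h1 : (algebraMap K L x) • σ q = ρ r := by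
    change _ = σ (f r)
    rw [← hqd, ← hx, map_mul, AlgHom.commutes,
      IsScalarTower.algebraMap_apply K L (Matrix (Fin n) (Fin n) L),
      ← Algebra.commutes, Algebra.smul_def]
  have hx1 : algebraMap K L x ≠ 0 := by simpa using hx0
  have h2 : σ q = (algebraMap K L x)⁻¹ • ρ r := by
    rw [← h1, smul_smul, inv_mul_cancel₀ hx1, one_smul]
  rw [h2]
  exact Submodule.smul_mem _ _ (Submodule.subset_span ⟨r, rfl⟩)

lemma lift_cjL {k L : Type} [Field k] [Field L] [Algebra k L] {n m : ℕ}
    (A : Fin m → Matrix (Fin n) (Fin n) L) (g : GL (Fin n) L) (p : FreeAlgebra k (Fin m)) :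
    FreeAlgebra.lift k (cjL g A) p * g.val = g.val * FreeAlgebra.lift k A p := by
  induction p using FreeAlgebra.induction with
  | grade0 r =>
    rw [AlgHom.commutes, AlgHom.commutes, Algebra.commutes]
  | grade1 x =>
    simp [cjL, mul_assoc]
  | mul a b ha hb => rw [map_mul, map_mul, mul_assoc, hb, ← mul_assoc, ha, mul_assoc]
  | add a b ha hb => rw [map_add, map_add, add_mul, ha, hb, mul_add]

/-- the ideal of polynomials vanishing on the conjugacy orbit of `A` -/
def orbP {k L : Type} [Field k] [Field L] [Algebra k L] {n m : ℕ}
    (A : Fin m → Matrix (Fin n) (Fin n) L) : Ideal (MvPolynomial (Fin m × Fin n × Fin n) k) where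
  carrier := {f | ∀ g : GL (Fin n) L, evL (cjL g A) f = 0}
  add_mem' := fun hf hg a => by rw [map_add, hf a, hg a, add_zero]
  zero_mem' := fun a => map_zero _
  smul_mem' := fun c f hf a => by rw [smul_eq_mul, map_mul, hf a, mul_zero]

lemma orbP_prime {k L : Type} [Field k] [Field L] [Infinite L] [Algebra k L] {n m : ℕ}
    (A : Fin m → Matrix (Fin n) (Fin n) L) : (orbP (k := k) A).IsPrime := by
  constructor
  · intro h
    have : (1 : MvPolynomial (Fin m × Fin n × Fin n) k) ∈ orbP A := by rw [h]; trivial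
    have := this 1
    simp at this
  · intro f f' hf
    exact conj_prime A f f' hf

lemma orbP_conj {k L : Type} [Field k] [Field L] [Algebra k L] {n m : ℕ}
    (A : Fin m → Matrix (Fin n) (Fin n) L) (t : GL (Fin n) k)
    (f : MvPolynomial (Fin m × Fin n × Fin n) k) (hf : f ∈ orbP A) :
    ∃ f' ∈ orbP (k := k) A, ∀ a : Fin m → Matrix (Fin n) (Fin n) k,
      evL (k := k) a f' = evL (cjL t a) f := by
  let cm : Matrix (Fin n) (Fin n) k → Matrix (Fin n) (Fin n) (MvPolynomial (Fin m × Fin n × Fin n) k) :=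
    fun M => M.map MvPolynomial.C
  let Xg : Fin m → Matrix (Fin n) (Fin n) (MvPolynomial (Fin m × Fin n × Fin n) k) :=
    fun h => Matrix.of fun i j => MvPolynomial.X (h, i, j)
  let θ : MvPolynomial (Fin m × Fin n × Fin n) k →ₐ[k] MvPolynomial (Fin m × Fin n × Fin n) k :=
    MvPolynomial.aeval fun x =>
      (cm t.val * Xg x.1 * cm (t⁻¹).val) x.2.1 x.2.2
  have key : ∀ (L' : Type) [Field L'] [Algebra k L'] (B : Fin m → Matrix (Fin n) (Fin n) L'),
      ∀ q, evL (k := k) B (θ q) =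
        evL (cjL (Matrix.GeneralLinearGroup.map (algebraMap k L') t) B) q := by
    intro L' _ _ B q
    have : (evL (k := k) B).comp θ =
        evL (cjL (Matrix.GeneralLinearGroup.map (algebraMap k L') t) B) := by
      apply MvPolynomial.algHom_ext
      rintro ⟨h, i, j⟩
      have hi : ((Matrix.GeneralLinearGroup.map (algebraMap k L') t)⁻¹).val =
          (t⁻¹).val.map (algebraMap k L') := by
        rw [← map_inv]; rfl
      have hj : (Matrix.GeneralLinearGroup.map (algebraMap k L') t).val =
          t.val.map (algebraMap k L') := rfl
      simp only [AlgHom.comp_apply, evL, θ, MvPolynomial.aeval_X, cjL, hi, hj, Matrix.mul_apply, map_sum,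
        map_mul, cm, Xg, Matrix.of_apply, Matrix.map_apply, MvPolynomial.aeval_C]
    rw [← this]; rfl
  refine ⟨θ f, fun g => ?_, fun a => ?_⟩
  · rw [key, cjL_mul]; exact hf _
  · rw [key]
    congr 1

lemma exists_words {k L : Type} [Field k] [Field L] [Algebra k L] {n m : ℕ}
    (A : Fin m → Matrix (Fin n) (Fin n) L)
    (hA : Submodule.span L (Set.range (FreeAlgebra.lift k A)) = ⊤) :
    ∃ w : Fin n × Fin n → FreeAlgebra k (Fin m),
      LinearIndependent L (fun x => FreeAlgebra.lift k A (w x)) ∧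
      Submodule.span L (Set.range fun x => FreeAlgebra.lift k A (w x)) = ⊤ := by
  obtain ⟨b, hb1, hb2, hb3⟩ := exists_linearIndependent L (Set.range (FreeAlgebra.lift k A))
  rw [hA] at hb2
  let B := Module.Basis.mk hb3 (by simp [hb2])
  let e := B.indexEquiv (Matrix.stdBasis L (Fin n) (Fin n))
  choose w hw using fun x : Fin n × Fin n => hb1 (e.symm x).2
  refine ⟨w, ?_⟩
  have : (fun x => FreeAlgebra.lift k A (w x)) = B.reindex e := by
    ext1 x
    rw [hw]; simp [B]
  rw [this]
  exact ⟨(B.reindex e).linearIndependent, (B.reindex e).span_eq⟩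

lemma disc {k : Type} [Field k] [IsAlgClosed k] [CharZero k] {n m : ℕ}
    (w : Fin n × Fin n → FreeAlgebra k (Fin m)) :
    ∃ d : PolyRing k n m, ∀ (L : Type) [Field L] [Algebra k L]
      (A : Fin m → Matrix (Fin n) (Fin n) L), evL A d ≠ 0 ↔
      (LinearIndependent L (fun x => FreeAlgebra.lift k A (w x)) ∧
      Submodule.span L (Set.range fun x => FreeAlgebra.lift k A (w x)) = ⊤) := by
  let D : Matrix (Fin n × Fin n) (Fin n × Fin n) (PolyRing k n m) := Matrix.of fun y x =>
    (FreeAlgebra.lift k (genericMatrix k n m) (w x)) y.1 y.2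
  refine ⟨D.det, ?_⟩
  intro L _ _ A
  rw [Module.Basis.is_basis_iff_det (Matrix.stdBasis L (Fin n) (Fin n)), isUnit_iff_ne_zero,
    Module.Basis.det_apply, AlgHom.map_det]
  have : (evL (k := k) A).mapMatrix D =
      (Matrix.stdBasis L (Fin n) (Fin n)).toMatrix fun x => FreeAlgebra.lift k A (w x) := by
    ext y x
    rw [Module.Basis.toMatrix_apply]
    simp only [evL_lift]
    simp [D, Matrix.stdBasis]
  rw [this]

lemma exist_part {k : Type} [Field k] [IsAlgClosed k] [CharZero k] {n : ℕ} (hn : 1 ≤ n)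
    (R : Type) [Ring R] [Algebra k R]
    (hfg : Algebra.FiniteType k R) (hdeg : HasPIDegree n R) :
    ∃ (m : ℕ), 2 ≤ m ∧ ∃ X : Set (MTuple k n m),
      IsNVariety k X ∧ IsIrredSubset k X ∧ Nonempty (R ≃ₐ[k] ↥(coordRing k X)) := by
  obtain ⟨L, _, _, _, ρ, hρ, hspan⟩ := embed_ring (k := k) hn hdeg
  have hinf : Infinite L := IsAlgClosed.instInfinite
  -- generators
  obtain ⟨m, hm, r, hr⟩ : ∃ m : ℕ, 2 ≤ m ∧ ∃ r : Fin m → R,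
      Function.Surjective (FreeAlgebra.lift k r) := by
    obtain ⟨s, hs⟩ := hfg.1
    refine ⟨s.card + 2, by omega,
      Fin.addCases (fun i => (s.equivFin.symm i : R)) (fun _ => 0), ?_⟩
    rw [← AlgHom.range_eq_top, ← Algebra.adjoin_range_eq_range_freeAlgebra_lift, eq_top_iff, ← hs]
    apply Algebra.adjoin_mono
    intro x hx
    exact ⟨Fin.castAdd 2 (s.equivFin ⟨x, hx⟩), by simp⟩
  let A : Fin m → Matrix (Fin n) (Fin n) L := fun h => ρ (r h)
  have hA : ∀ p, FreeAlgebra.lift k A p = ρ (FreeAlgebra.lift k r p) := by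
    have : FreeAlgebra.lift k A = ρ.comp (FreeAlgebra.lift k r) := by
      apply FreeAlgebra.hom_ext
      ext1 h
      simp [A]
    intro p; rw [this]; rfl
  have hA0 : ∀ p, FreeAlgebra.lift k A p = 0 ↔ FreeAlgebra.lift k r p = 0 := by
    intro p; rw [hA, map_eq_zero_iff ρ hρ]
  have hAs : Submodule.span L (Set.range (FreeAlgebra.lift k A)) = ⊤ := by
    rw [← hspan]
    congr 1
    ext x
    constructor
    · rintro ⟨p, rfl⟩; exact ⟨_, (hA p).symm⟩
    · rintro ⟨y, rfl⟩
      obtain ⟨p, rfl⟩ := hr y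
      exact ⟨p, hA p⟩
  obtain ⟨w, hw⟩ := exists_words A hAs
  obtain ⟨d, hd⟩ := disc w
  have hP := orbP_prime (k := k) A
  have hdP : d ∉ orbP A := by
    intro h
    have h1 := h 1
    rw [cjL_one] at h1
    exact (hd L A).mpr hw h1
  let X : Set (MTuple k n m) := {a | ∀ f ∈ (orbP (k := k) A : Set (PolyRing k n m)), polyEval k a f = 0} ∩
    genTuples k n m
  have hdX : ∀ a : MTuple k n m, polyEval k a d ≠ 0 → a ∈ genTuples k n m := by
    intro a ha
    have h1 := ((hd k a).mp ha).2
    rw [mem_genTuples_iff]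
    intro M
    have h2 : M ∈ Submodule.span k (Set.range fun x => FreeAlgebra.lift k a (w x)) := by
      rw [h1]; trivial
    have h3 : Submodule.span k (Set.range fun x => FreeAlgebra.lift k a (w x)) ≤
        LinearMap.range (FreeAlgebra.lift k a).toLinearMap := by
      rw [Submodule.span_le]
      rintro _ ⟨x, rfl⟩
      exact ⟨w x, rfl⟩
    exact h3 h2
  have hvan : ∀ f : PolyRing k n m, (∀ a ∈ X, polyEval k a f = 0) → f ∈ orbP A := by
    intro f hf
    have h1 : f * d ∈ MvPolynomial.vanishingIdeal k (MvPolynomial.zeroLocus k (orbP (k := k) A)) := by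
      rw [MvPolynomial.mem_vanishingIdeal_iff]
      intro v hv
      rw [MvPolynomial.mem_zeroLocus_iff] at hv
      let a : MTuple k n m := fun h => Matrix.of fun i j => v (h, i, j)
      have ha : ∀ q, MvPolynomial.aeval v q = polyEval k a q := fun q => rfl
      rw [ha, map_mul]
      by_cases h0 : polyEval k a d = 0
      · rw [h0, mul_zero]
      · rw [hf a ⟨fun q hq => hv q hq, hdX a h0⟩, zero_mul]
    rw [MvPolynomial.vanishingIdeal_zeroLocus_eq_radical, hP.radical] at h1
    exact (hP.mem_or_mem h1).resolve_right hdP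
  have hvan' : ∀ f ∈ orbP A, ∀ a ∈ X, polyEval k a f = 0 := fun f hf a ha => ha.1 f hf
  refine ⟨m, hm, X, ⟨fun a ha => ha.2, ?_, _, ⟨_, rfl⟩, rfl⟩, ⟨?_, ?_⟩, ?_⟩
  · intro t a ha
    refine ⟨fun f hf => ?_, ?_⟩
    · obtain ⟨f', hf', hff⟩ := orbP_conj A t f hf
      have h1 : polyEval k (conjAct k t a) f = polyEval k a f' := (hff a).symm
      rw [h1]
      exact ha.1 f' hf'
    · rw [mem_genTuples_iff]
      intro M
      obtain ⟨p, hp⟩ := (mem_genTuples_iff a).mp ha.2 ((t⁻¹).val * M * t.val)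
      refine ⟨p, ?_⟩
      have h1 : FreeAlgebra.lift k (conjAct k t a) p * t.val = t.val * FreeAlgebra.lift k a p :=
        lift_cjL a t p
      rw [hp, ← mul_assoc, ← mul_assoc, Units.mul_inv, one_mul] at h1
      exact t.isUnit.mul_right_cancel h1
  · by_contra hne
    rw [Set.not_nonempty_iff_eq_empty] at hne
    apply hP.ne_top
    rw [Ideal.eq_top_iff_one]
    apply hvan
    rw [hne]
    intro a ha
    exact absurd ha (Set.notMem_empty a)
  · rintro _ _ ⟨S₁, rfl⟩ ⟨S₂, rfl⟩ hS
    by_contra! hcon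
    obtain ⟨h1, h2⟩ := hcon
    obtain ⟨a1, ha1, hb1⟩ := Set.not_subset.mp h1
    obtain ⟨a2, ha2, hb2⟩ := Set.not_subset.mp h2
    simp only [Set.mem_ofPred_eq, not_forall] at hb1 hb2
    obtain ⟨f1, hf1, hn1⟩ := hb1
    obtain ⟨f2, hf2, hn2⟩ := hb2
    have h3 : f1 * f2 ∈ orbP A := by
      apply hvan
      intro a ha
      rw [map_mul]
      rcases hS ha with h | h
      · rw [h f1 hf1, zero_mul]
      · rw [h f2 hf2, mul_zero]
    rcases hP.mem_or_mem h3 with h | h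
    · exact hn1 (hvan' f1 h a1 ha1)
    · exact hn2 (hvan' f2 h a2 ha2)
  · obtain ⟨π, hπ, hπ'⟩ := coord_surj X
    have hker : ∀ p, π p = 0 ↔ FreeAlgebra.lift k r p = 0 := by
      intro p
      rw [← hA0]
      constructor
      · intro h
        have h1 : ∀ a ∈ X, FreeAlgebra.lift k a p = 0 := by
          intro a ha
          rw [← hπ' p ⟨a, ha⟩, h]; rfl
        rw [evL_lift]
        ext i j
        have h2 : (FreeAlgebra.lift k (genericMatrix k n m) p) i j ∈ orbP A := by
          apply hvan
          intro a ha
          have h3 := h1 a ha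
          rw [← eval_lift] at h3
          exact congrFun (congrFun h3 i) j
        have h4 := h2 1
        rw [cjL_one] at h4
        exact h4
      · intro h
        apply Subtype.ext
        ext1 a
        rw [hπ', ← eval_lift]
        ext i j
        change polyEval k a.val ((FreeAlgebra.lift k (genericMatrix k n m) p) i j) = 0
        refine hvan' _ ?_ a.val a.2
        intro g
        have h1 := lift_cjL A g p
        rw [h, mul_zero] at h1
        have h2 : FreeAlgebra.lift k (cjL g A) p = 0 := by
          apply g.isUnit.mul_right_cancel
          rw [h1, zero_mul]
        rw [evL_lift] at h2
        exact congrFun (congrFun h2 i) j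
    obtain ⟨θ, hθ⟩ := lift_surj (FreeAlgebra.lift k r) hr π (fun p hp => (hker p).mpr hp)
    refine ⟨AlgEquiv.ofBijective θ ⟨?_, ?_⟩⟩
    · rw [injective_iff_map_eq_zero]
      intro x hx
      obtain ⟨p, rfl⟩ := hr x
      rw [hθ] at hx
      exact (hker p).mp hx
    · intro y
      obtain ⟨p, rfl⟩ := hπ y
      exact ⟨_, hθ p⟩

end Helpers

/-- **Statement 15** (Theorem thm.n-Var).  Let `R` be a finitely generated prime
`k`-algebra of PI-degree `n`.  Then `R` is isomorphic (as a `k`-algebra) to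
`k_n[X]` for some irreducible `n`-variety `X`.  Moreover `X` is uniquely
determined by `R`, up to isomorphism of `n`-varieties. -/
theorem coordinate_ring_realization (n : ℕ) (hn : 1 ≤ n)
    (R : Type) [Ring R] [Algebra k R]
    (hfg : Algebra.FiniteType k R) (hprime : IsPrimeRing R) (hdeg : HasPIDegree n R) :
    (∃ (m : ℕ), 2 ≤ m ∧ ∃ X : Set (MTuple k n m),
      IsNVariety k X ∧ IsIrredSubset k X ∧ Nonempty (R ≃ₐ[k] ↥(coordRing k X))) ∧
    (∀ (m m' : ℕ), 2 ≤ m → 2 ≤ m' →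
      ∀ (X : Set (MTuple k n m)) (X' : Set (MTuple k n m')),
        IsNVariety k X → IsIrredSubset k X → IsNVariety k X' → IsIrredSubset k X' →
        Nonempty (R ≃ₐ[k] ↥(coordRing k X)) → Nonempty (R ≃ₐ[k] ↥(coordRing k X')) →
        NIsomorphic k X X') := by
  refine ⟨exist_part hn R hfg hdeg, ?_⟩
  intro m m' _ _ X X' hX hXi hX' hXi' hR hR'
  obtain ⟨e⟩ := hR
  obtain ⟨e'⟩ := hR'
  exact uniq hn X X' hX hXi hX' hXi' (e'.symm.trans e)

end
end

section
/- Let X ⊆ U_{m,n} be an irreducible n-variety. Then the natural inclusion of k_n(X) into the k-algebra RMaps_{PGL_n}(X, M_n) of PGL_n-equivariant rational maps X ⇢ M_n is an isomorphism. That is, every PGL_n-equivariant rational map X ⇢ M_n can be written as c^{-1}p, where p ∈ k_n[X] and c is a nonzero central element of k_n[X]. -/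
set_option linter.unusedSectionVars false

noncomputable section

universe u

-- Throughout, `k` is an algebraically closed base field of characteristic zero.
variable (k : Type) [Field k] [IsAlgClosed k] [CharZero k]

section HelpersField
open TensorProduct Polynomial

theorem field_amalgam {F L E : Type} [Field F] [Field L] [Field E] (α : F →+* L) (β : F →+* E) :
    ∃ (Ω : Type) (_ : Field Ω) (s : L →+* Ω) (t : E →+* Ω), ∀ x, s (α x) = t (β x) := by
  let := α.toAlgebra
  let := β.toAlgebra
  obtain ⟨M, hM⟩ := Ideal.exists_maximal (L ⊗[F] E)
  let := Ideal.Quotient.field M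
  refine ⟨(L ⊗[F] E) ⧸ M, inferInstance,
    (Ideal.Quotient.mk M).comp (Algebra.TensorProduct.includeLeftRingHom),
    (Ideal.Quotient.mk M).comp
      (Algebra.TensorProduct.includeRight : E →ₐ[F] L ⊗[F] E).toRingHom, fun x => ?_⟩
  simp only [RingHom.comp_apply]
  congr 1
  have h1 : α x = algebraMap F L x := rfl
  have h2 : β x = algebraMap F E x := rfl
  rw [h1, h2]
  simp [Algebra.algebraMap_eq_smul_one, TensorProduct.smul_tmul]

theorem field_separate {K L : Type} [Field K] [CharZero K] [Field L] [Algebra K L] (f : L)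
    (hf : f ∉ (algebraMap K L).range) :
    ∃ (Ω : Type) (_ : Field Ω) (s t : L →+* Ω),
      (∀ x : K, s (algebraMap K L x) = t (algebraMap K L x)) ∧ s f ≠ t f := by
  by_cases halg : IsAlgebraic K f
  · have hintg := halg.isIntegral
    set E := AlgebraicClosure L
    have hirr := minpoly.irreducible hintg
    obtain ⟨f', hf', hne⟩ : ∃ f' : E, aeval f' (minpoly K f) = 0 ∧ f' ≠ algebraMap L E f := by
      by_contra hcon
      push Not at hcon
      have hcard := Polynomial.card_rootSet_eq_natDegree (K := E) hirr.separable
        (IsAlgClosed.splits _)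
      have hle : Fintype.card ((minpoly K f).rootSet E) ≤ 1 := by
        rw [Fintype.card_le_one_iff]
        rintro ⟨x, hx⟩ ⟨y, hy⟩
        have hx := hcon x (Polynomial.aeval_eq_zero_of_mem_rootSet hx)
        have hy := hcon y (Polynomial.aeval_eq_zero_of_mem_rootSet hy)
        simp [hx, hy]
      have hpos := minpoly.natDegree_pos hintg
      exact hf (minpoly.natDegree_eq_one_iff.mp (by omega))
    have : Fact (Irreducible (minpoly K f)) := ⟨hirr⟩
    let α : AdjoinRoot (minpoly K f) →+* L :=
      AdjoinRoot.lift (algebraMap K L) f (minpoly.aeval K f)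
    let β : AdjoinRoot (minpoly K f) →+* E :=
      AdjoinRoot.lift (algebraMap K E) f' hf'
    obtain ⟨Ω, iΩ, s, t, h⟩ := field_amalgam α β
    refine ⟨Ω, iΩ, s, t.comp (algebraMap L E), fun x => ?_, ?_⟩
    · have e1 : α (AdjoinRoot.of _ x) = algebraMap K L x := AdjoinRoot.lift_of _
      have e2 : β (AdjoinRoot.of _ x) = algebraMap K E x := AdjoinRoot.lift_of _
      have := h (AdjoinRoot.of _ x)
      rw [e1, e2] at this
      rw [this, RingHom.comp_apply, ← IsScalarTower.algebraMap_apply]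
    · have e1 : α (AdjoinRoot.root _) = f := AdjoinRoot.lift_root _
      have e2 : β (AdjoinRoot.root _) = f' := AdjoinRoot.lift_root _
      have := h (AdjoinRoot.root _)
      rw [e1, e2] at this
      rw [this]
      intro h
      exact hne (t.injective h)
  · have htr : Transcendental K f := halg
    have htr1 : Transcendental K (f + 1) := by
      intro h
      apply halg
      have := h.sub (isAlgebraic_one (R := K) (A := L))
      simpa using this
    have i1 := transcendental_iff_injective.mp htr
    have i2 := transcendental_iff_injective.mp htr1
    let α : FractionRing K[X] →+* L := IsFractionRing.lift (g := (aeval f : K[X] →ₐ[K] L).toRingHom) i1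
    let β : FractionRing K[X] →+* L := IsFractionRing.lift (g := (aeval (f+1) : K[X] →ₐ[K] L).toRingHom) i2
    obtain ⟨Ω, iΩ, s, t, h⟩ := field_amalgam α β
    have h' : ∀ p : K[X], s (aeval f p) = t (aeval (f+1) p) := by
      intro p
      have := h (algebraMap _ _ p)
      simpa [α, β, IsFractionRing.lift_algebraMap] using this
    refine ⟨Ω, iΩ, s, t, fun x => ?_, ?_⟩
    · simpa using h' (C x)
    · have := h' X
      simp at this
      simp [this]

end HelpersField


/-- Explicit Capelli-type element. -/
def capel {A : Type*} [Ring A] {N : ℕ} (a c b : Fin N → A) : A :=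
  ∑ π : Equiv.Perm (Fin N), Equiv.Perm.sign π • (List.ofFn fun l => a l * b (π l) * c l).prod

theorem capel_map {A B : Type*} [Ring A] [Ring B] {N : ℕ} (f : A →+* B) (a c b : Fin N → A) :
    f (capel a c b) = capel (fun i => f (a i)) (fun i => f (c i)) (fun i => f (b i)) := by
  simp only [capel, map_sum, Units.smul_def, map_zsmul, map_list_prod, List.map_ofFn]
  refine Finset.sum_congr rfl fun π _ => ?_
  congr 3
  funext l
  simp

section
variable {R A : Type*} [CommRing R] [Ring A] [Algebra R A] {N : ℕ}

/-- The monomial `∏ a_l v_l c_l` as multilinear map. -/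
noncomputable def capelM (R : Type*) {A : Type*} [CommRing R] [Ring A] [Algebra R A] {N : ℕ}
    (a c : Fin N → A) : MultilinearMap R (fun _ : Fin N => A) A :=
  (MultilinearMap.mkPiAlgebraFin R N A).compLinearMap
    (fun l => LinearMap.mulLeftRight R (a l, c l))

theorem capelM_apply (a c v : Fin N → A) :
    capelM R a c v = (List.ofFn fun l => a l * v l * c l).prod := by
  simp [capelM]

/-- Capelli alternating map -/
noncomputable def capelD (R : Type*) {A : Type*} [CommRing R] [Ring A] [Algebra R A] {N : ℕ}
    (a c : Fin N → A) : A [⋀^Fin N]→ₗ[R] A := (capelM R a c).alternatization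

theorem capelD_apply (a c b : Fin N → A) : capelD R a c b = capel a c b := by
  simp [capelD, capel, MultilinearMap.alternatization_apply, capelM_apply]

/-- one slot of a product -/
theorem slot {A : Type*} [Ring A] {S : Type*} [SetLike S A] [SubmonoidClass S A] (s : S) {N : ℕ}
    (f : Fin N → A) (hf : ∀ i, f i ∈ s) (j : Fin N) (p r : A) (hp : p ∈ s) (hr : r ∈ s) :
    ∃ u ∈ s, ∃ v ∈ s, ∀ y, (List.ofFn (Function.update f j (p * y * r))).prod = u * y * v := by
  refine ⟨((List.ofFn f).take j).prod * p, mul_mem (list_prod_mem ?_) hp,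
    r * ((List.ofFn f).drop (j+1)).prod, mul_mem hr (list_prod_mem ?_), fun y => ?_⟩
  · intro x hx
    obtain ⟨i, rfl⟩ := List.mem_ofFn.mp (List.mem_of_mem_take hx)
    exact hf i
  · intro x hx
    obtain ⟨i, rfl⟩ := List.mem_ofFn.mp (List.mem_of_mem_drop hx)
    exact hf i
  · have : List.ofFn (Function.update f j (p * y * r)) = (List.ofFn f).set j (p * y * r) := by
      apply List.ext_getElem
      · simp
      · intro i h1 h2
        simp [List.getElem_set, Function.update_apply, Fin.ext_iff, eq_comm]
    rw [this, List.prod_set]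
    simp [mul_assoc]

/-- the derivation-type alternating map -/
noncomputable def derD (M : MultilinearMap R (fun _ : Fin N => A) A) (T : A →ₗ[R] A) :
    A [⋀^Fin N]→ₗ[R] A :=
  (∑ j, M.compLinearMap (Function.update (fun _ => LinearMap.id) j T)).alternatization

theorem derD_apply (M : MultilinearMap R (fun _ : Fin N => A) A) (T : A →ₗ[R] A) (b : Fin N → A) :
    derD M T b = ∑ π : Equiv.Perm (Fin N), ∑ j, Equiv.Perm.sign π •
      M (Function.update (b ∘ π) j (T (b (π j)))) := by
  simp only [derD, MultilinearMap.alternatization_apply, MultilinearMap.domDomCongr_apply,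
    sum_apply, MultilinearMap.compLinearMap_apply, Finset.smul_sum]
  refine Finset.sum_congr rfl fun π _ => Finset.sum_congr rfl fun j _ => ?_
  congr 2
  funext l
  by_cases h : l = j
  · subst h; simp
  · simp [h]

theorem derD_apply' (M : MultilinearMap R (fun _ : Fin N => A) A) (T : A →ₗ[R] A) (b : Fin N → A) :
    derD M T b = ∑ i, M.alternatization (Function.update b i (T (b i))) := by
  rw [derD_apply]
  simp only [MultilinearMap.alternatization_apply, MultilinearMap.domDomCongr_apply]
  rw [Finset.sum_comm (s := Finset.univ (α := Fin N))]
  refine Finset.sum_congr rfl fun π _ => ?_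
  conv_rhs => rw [← Equiv.sum_comp π]
  refine Finset.sum_congr rfl fun j _ => ?_
  congr 2
  funext l
  by_cases h : l = j
  · subst h; simp
  · simp [h]

theorem derD_eq (M : MultilinearMap R (fun _ : Fin N => A) A) (T : A →ₗ[R] A)
    (e : Module.Basis (Fin N) R A) :
    derD M T = (∑ i, e.repr (T (e i)) i) • M.alternatization := by
  refine Module.Basis.ext_alternating e ?_
  intro v hv
  let σ : Equiv.Perm (Fin N) := Equiv.ofBijective v (Finite.injective_iff_bijective.mp hv)
  have hσ : (fun i => e (v i)) = e ∘ σ := rfl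
  rw [hσ, AlternatingMap.map_perm, AlternatingMap.map_perm]
  congr 1
  rw [derD_apply', AlternatingMap.smul_apply, Finset.sum_smul]
  refine Finset.sum_congr rfl fun i _ => ?_
  conv_lhs => rw [← e.sum_repr (T (e i))]
  rw [AlternatingMap.map_update_sum, Finset.sum_eq_single i]
  · rw [AlternatingMap.map_update_smul, Function.update_eq_self]
  · intro j _ hj
    rw [AlternatingMap.map_update_smul, AlternatingMap.map_update_self _ _ hj.symm, smul_zero]
  · simp
end

section
variable {R : Type*} [CommRing R] {n : ℕ}

/-- matrix unit basis indexed by `Fin (n*n)`. -/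
noncomputable def eB (R : Type*) [CommRing R] (n : ℕ) :
    Module.Basis (Fin (n * n)) R (Matrix (Fin n) (Fin n) R) :=
  (Matrix.stdBasis R (Fin n) (Fin n)).reindex finProdFinEquiv

theorem eB_apply (i j : Fin n) : eB R n (finProdFinEquiv (i, j)) = Matrix.single i j 1 := by
  simp [eB, Matrix.stdBasis_eq_single]

theorem eB_repr (x : Matrix (Fin n) (Fin n) R) (i j : Fin n) :
    (eB R n).repr x (finProdFinEquiv (i, j)) = x i j := by
  simp [eB, Matrix.stdBasis, Module.Basis.repr_reindex]

theorem eB_trace (y : Matrix (Fin n) (Fin n) R) :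
    ∑ i, (eB R n).repr (LinearMap.mulLeft R y (eB R n i)) i = n * y.trace := by
  rw [← Equiv.sum_comp finProdFinEquiv, Fintype.sum_prod_type]
  have : ∀ i j : Fin n, (eB R n).repr (LinearMap.mulLeft R y (eB R n (finProdFinEquiv (i,j))))
      (finProdFinEquiv (i,j)) = y i i := by
    intro i j
    rw [eB_repr, eB_apply]
    simp
  simp only [this]
  simp [Matrix.trace, Finset.mul_sum]

theorem capel_central {k : Type*} [CommRing k] [Algebra k R]
    (S : Subalgebra k (Matrix (Fin n) (Fin n) R)) (a c b : Fin (n*n) → Matrix (Fin n) (Fin n) R)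
    (ha : ∀ i, a i ∈ S) (hc : ∀ i, c i ∈ S) (hb : ∀ i, b i ∈ S) :
    algebraMap R (Matrix (Fin n) (Fin n) R) (n * (capel a c b).trace) ∈ S := by
  have key : ∀ (π : Equiv.Perm (Fin (n*n))) (j : Fin (n*n)), ∃ u ∈ S, ∃ v ∈ S,
      ∀ y, capelM R a c (Function.update (b ∘ π) j (LinearMap.mulLeft R y (b (π j)))) = u * y * v := by
    intro π j
    obtain ⟨u, hu, v, hv, h⟩ := slot S (fun l => a l * b (π l) * c l)
      (fun i => mul_mem (mul_mem (ha i) (hb _)) (hc i)) j (a j) (b (π j) * c j) (ha j)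
        (mul_mem (hb _) (hc j))
    refine ⟨u, hu, v, hv, fun y => ?_⟩
    rw [← h y, capelM_apply]
    congr 2
    funext l
    by_cases hl : l = j
    · subst hl; simp [mul_assoc]
    · simp [hl]
  choose u hu v hv h using key
  have hmem : (∑ π : Equiv.Perm (Fin (n*n)), ∑ j, Equiv.Perm.sign π • (v π j * u π j)) ∈ S := by
    refine sum_mem fun π _ => sum_mem fun j _ => ?_
    rw [Units.smul_def]
    exact zsmul_mem (mul_mem (hv _ _) (hu _ _)) _
  convert hmem using 1
  rw [Matrix.ext_iff_trace_mul_left]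
  intro y
  have h1 := derD_apply (capelM R a c) (LinearMap.mulLeft R y) b
  rw [derD_eq _ _ (eB R n), eB_trace] at h1
  simp only [h] at h1
  have h2 := congrArg Matrix.trace h1
  rw [AlternatingMap.smul_apply] at h2
  change Matrix.trace ((_ : R) • capelD R a c b) = _ at h2
  rw [capelD_apply, Matrix.trace_smul] at h2
  simp only [Finset.mul_sum, Matrix.trace_sum, Units.smul_def, Matrix.trace_smul, mul_smul_comm] at h2 ⊢
  have h3 : y * algebraMap R (Matrix (Fin n) (Fin n) R) (n * (capel a c b).trace) =
      (n * (capel a c b).trace) • y := by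
    rw [Algebra.smul_def, Algebra.commutes]
  rw [h3, Matrix.trace_smul]
  trans (↑n * y.trace) • (capel a c b).trace
  · simp only [smul_eq_mul]; ring
  · rw [h2]
    refine Finset.sum_congr rfl fun π _ => Finset.sum_congr rfl fun j _ => ?_
    rw [mul_assoc, Matrix.trace_mul_comm, mul_assoc]

/-- left multipliers -/
noncomputable def uA (R : Type*) [CommRing R] (n : ℕ) (z : Fin n) (l : Fin (n * n)) :
    Matrix (Fin n) (Fin n) R :=
  Matrix.single z (finProdFinEquiv.symm l).1 1

/-- right multipliers -/
noncomputable def uC (R : Type*) [CommRing R] (n : ℕ) (z : Fin n) (l : Fin (n * n)) :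
    Matrix (Fin n) (Fin n) R :=
  Matrix.single (finProdFinEquiv.symm l).2 z 1

theorem uprod (z : Fin n) (l l' : Fin (n * n)) :
    uA R n z l * eB R n l' * uC R n z l = if l' = l then Matrix.single z z 1 else 0 := by
  obtain ⟨⟨i, j⟩, rfl⟩ := finProdFinEquiv.surjective l
  obtain ⟨⟨i', j'⟩, rfl⟩ := finProdFinEquiv.surjective l'
  rw [eB_apply]
  simp only [uA, uC, Equiv.symm_apply_apply, EmbeddingLike.apply_eq_iff_eq, Prod.mk.injEq]
  by_cases h1 : i' = i
  · subst h1
    by_cases h2 : j' = j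
    · subst h2; simp
    · simp [h2]
  · rw [Matrix.single_mul_single_of_ne _ _ _ _ (Ne.symm h1)]
    simp [h1]

theorem capel_units (z : Fin n) : (capel (uA R n z) (uC R n z) (eB R n)).trace = 1 := by
  have hN : n * n ≠ 0 := by
    have := z.pos
    positivity
  have : capel (uA R n z) (uC R n z) (eB R n) = Matrix.single z z 1 := by
    rw [capel, Finset.sum_eq_single 1]
    · simp only [uprod, Equiv.Perm.one_apply, if_true, Equiv.Perm.sign_one, one_smul]
      rw [List.ofFn_const, List.prod_replicate]
      exact IsIdempotentElem.pow_eq (by simp [IsIdempotentElem]) hN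
    · intro π _ hπ
      obtain ⟨l, hl⟩ : ∃ l, π l ≠ l := by
        by_contra hcon
        push Not at hcon
        exact hπ (Equiv.ext hcon)
      rw [List.prod_eq_zero, smul_zero]
      rw [List.mem_ofFn]
      exact ⟨l, by rw [uprod, if_neg hl]⟩
    · simp
  rw [this]
  simp

end

theorem cramer_alt {L V : Type*} [Field L] [AddCommGroup V] [Module L V] {N : ℕ}
    (e : Module.Basis (Fin N) L V) (g : V [⋀^Fin N]→ₗ[L] L) (b : Fin N → V) (hb : g b ≠ 0) :
    LinearIndependent L b ∧ ∀ r, r = ∑ i, ((g (Function.update b i r)) / g b) • b i := by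
  have hli : LinearIndependent L b := by
    by_contra h
    exact hb (g.map_linearDependent b h)
  refine ⟨hli, fun r => ?_⟩
  have : Module.Finite L V := Module.Finite.of_basis e
  let B := basisOfLinearIndependentOfCardEqFinrank' b hli (by
    rw [Module.finrank_eq_card_basis e])
  have hB : ⇑B = b := by simp [B]
  have hr := B.sum_repr r
  rw [hB] at hr
  conv_lhs => rw [← hr]
  refine Finset.sum_congr rfl fun i _ => ?_
  congr 1
  rw [eq_div_iff hb]
  conv_rhs => rw [← hr]
  rw [AlternatingMap.map_update_sum, Finset.sum_eq_single i]
  · rw [AlternatingMap.map_update_smul, Function.update_eq_self, smul_eq_mul]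
  · intro j _ hj
    rw [AlternatingMap.map_update_smul, AlternatingMap.map_update_self _ _ hj.symm, smul_zero]
  · simp

theorem cramer_capel {L : Type*} [Field L] {n : ℕ} (a c b : Fin (n * n) → Matrix (Fin n) (Fin n) L)
    (hb : (capel a c b).trace ≠ 0) :
    LinearIndependent L b ∧
      ∀ r, r = ∑ i, ((capel a c (Function.update b i r)).trace / (capel a c b).trace) • b i := by
  have := cramer_alt (eB L n)
    ((Matrix.traceLinearMap (Fin n) L L).compAlternatingMap (capelD L a c)) b
  simp only [LinearMap.compAlternatingMap_apply, capelD_apply, Matrix.traceLinearMap_apply] at this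
  exact this hb

/-- Skolem-Noether for tuples given by bases. -/
theorem skolem_basis {Ω : Type*} [Field Ω] {n N : ℕ} (b b' : Fin N → Matrix (Fin n) (Fin n) Ω)
    (hN : N = n * n) (hb : LinearIndependent Ω b) (hb' : LinearIndependent Ω b')
    (γ : Fin N → Fin N → Fin N → Ω) (hγ : ∀ i j, b i * b j = ∑ l, γ i j l • b l)
    (hγ' : ∀ i j, b' i * b' j = ∑ l, γ i j l • b' l)
    (u : Fin N → Ω) (hu : 1 = ∑ l, u l • b l) (hu' : 1 = ∑ l, u l • b' l) :
    ∃ g : GL (Fin n) Ω, ∀ i, b' i = (g : Matrix (Fin n) (Fin n) Ω) * b i *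
      ((g⁻¹ : GL (Fin n) Ω) : Matrix (Fin n) (Fin n) Ω) := by
  have hcard : Fintype.card (Fin N) = Module.finrank Ω (Matrix (Fin n) (Fin n) Ω) := by
    rw [Module.finrank_eq_card_basis (eB Ω n), hN]
  let B := basisOfLinearIndependentOfCardEqFinrank' b hb hcard
  let B' := basisOfLinearIndependentOfCardEqFinrank' b' hb' hcard
  have hB : ∀ i, B i = b i := fun i => by simp [B]
  have hB' : ∀ i, B' i = b' i := fun i => by simp [B']
  let e : Matrix (Fin n) (Fin n) Ω ≃ₗ[Ω] Matrix (Fin n) (Fin n) Ω := B.equiv B' (Equiv.refl _)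
  have he : ∀ i, e (b i) = b' i := fun i => by
    rw [← hB, ← hB']; simp [e]
  have hone : e 1 = 1 := by
    rw [hu, map_sum]; simp only [map_smul, he]; rw [← hu']; exact hu
  have hmul : ∀ x y, e (x * y) = e x * e y := by
    intro x y
    have hmm : (LinearMap.mul Ω (Matrix (Fin n) (Fin n) Ω)).compr₂ e.toLinearMap =
        (LinearMap.mul Ω (Matrix (Fin n) (Fin n) Ω)).compl₁₂ e.toLinearMap e.toLinearMap := by
      refine LinearMap.ext_basis B B fun i j => ?_
      simp only [LinearMap.compr₂_apply, LinearMap.mul_apply', LinearMap.compl₁₂_apply, hB,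
        LinearEquiv.coe_coe, he, hγ, hγ', map_sum, map_smul]
    exact LinearMap.congr_fun₂ hmm x y
  let θ := AlgEquiv.ofLinearEquiv e hone hmul
  let τ : Matrix (Fin n) (Fin n) Ω ≃ₐ[Ω] Module.End Ω (Fin n → Ω) := Matrix.toLinAlgEquiv'
  obtain ⟨T, hT⟩ := AlgEquiv.eq_linearEquivConjAlgEquiv ((τ.symm.trans θ).trans τ)
  let g : GL (Fin n) Ω :=
    ⟨τ.symm T.toLinearMap, τ.symm T.symm.toLinearMap, by
      rw [← map_mul, ← map_one τ.symm]; congr 1; ext; simp, by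
      rw [← map_mul, ← map_one τ.symm]; congr 1; ext; simp⟩
  refine ⟨g, fun i => ?_⟩
  have h1 := congrArg (fun f => f (τ (b i))) hT
  simp only [AlgEquiv.trans_apply, AlgEquiv.symm_apply_apply] at h1
  have h2 : θ (b i) = b' i := he i
  rw [h2] at h1
  apply τ.injective
  rw [h1, map_mul, map_mul]
  change _ = τ (τ.symm _) * _ * τ (τ.symm _)
  rw [AlgEquiv.apply_symm_apply, AlgEquiv.apply_symm_apply]
  rfl

/-- Vanishing ideal of `X` in the polynomial ring. -/
def vanI {n m : ℕ} (X : Set (MTuple k n m)) : Ideal (PolyRing k n m) where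
  carrier := {p | ∀ a ∈ X, polyEval k a p = 0}
  add_mem' := fun {p q} hp hq a ha => by rw [map_add, hp a ha, hq a ha, add_zero]
  zero_mem' := fun a _ => map_zero _
  smul_mem' := fun c p hp a ha => by rw [smul_eq_mul, map_mul, hp a ha, mul_zero]

theorem mem_vanI {n m : ℕ} (X : Set (MTuple k n m)) (p : PolyRing k n m) :
    p ∈ vanI k X ↔ ∀ a ∈ X, polyEval k a p = 0 := Iff.rfl

theorem vanI_prime {n m : ℕ} (X : Set (MTuple k n m)) (h : IsIrredSubset k X) :
    (vanI k X).IsPrime := by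
  refine ⟨?_, fun {p q} hpq => ?_⟩
  · intro htop
    obtain ⟨a, ha⟩ := h.1
    have h1 : (1 : PolyRing k n m) ∈ vanI k X := htop ▸ Submodule.mem_top
    have := h1 a ha
    rw [map_one] at this
    exact one_ne_zero this
  · have := h.2 {a | ∀ r ∈ ({p} : Set (PolyRing k n m)), polyEval k a r = 0}
      {a | ∀ r ∈ ({q} : Set (PolyRing k n m)), polyEval k a r = 0} ⟨_, rfl⟩ ⟨_, rfl⟩ (by
        intro a ha
        have := hpq a ha
        rw [map_mul, mul_eq_zero] at this
        simpa using this)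
    rcases this with h | h
    · left; intro a ha; exact h ha p rfl
    · right; intro a ha; exact h ha q rfl

theorem evalMat_generic {n m : ℕ} (a : MTuple k n m) (h : Fin m) :
    evalMat k a (genericMatrix k n m h) = a h := by
  ext i j
  simp [evalMat, genericMatrix, polyEval]

theorem evalMat_conj {n m : ℕ} (g : GL (Fin n) k) (x : MTuple k n m) (p : MatPoly k n m)
    (hp : p ∈ GMN k n m) :
    evalMat k (conjAct k g x) p = (g : Matrix (Fin n) (Fin n) k) * evalMat k x p *
      ((g⁻¹ : GL (Fin n) k) : Matrix (Fin n) (Fin n) k) := by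
  have hg : ((g⁻¹ : GL (Fin n) k) : Matrix (Fin n) (Fin n) k) * (g : Matrix (Fin n) (Fin n) k) = 1 :=
    by rw [← Units.val_mul]; simp
  have hg' : (g : Matrix (Fin n) (Fin n) k) * ((g⁻¹ : GL (Fin n) k) : Matrix (Fin n) (Fin n) k) = 1 :=
    by rw [← Units.val_mul]; simp
  induction hp using Algebra.adjoin_induction with
  | mem p hp =>
    obtain ⟨h, rfl⟩ := hp
    simp only [evalMat_generic, conjAct]
  | algebraMap r =>
    rw [AlgHom.commutes, AlgHom.commutes, ← Algebra.commutes, mul_assoc, hg', mul_one]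
  | add p q _ _ hp hq => rw [map_add, map_add, hp, hq, mul_add, add_mul]
  | mul p q _ _ hp hq =>
    rw [map_mul, map_mul, hp, hq]
    generalize evalMat k x p = a
    generalize evalMat k x q = b
    calc _ = (g : Matrix (Fin n) (Fin n) k) * a * (((g⁻¹ : GL (Fin n) k) : Matrix (Fin n) (Fin n) k) *
          (g : Matrix (Fin n) (Fin n) k)) * b * ((g⁻¹ : GL (Fin n) k) : Matrix (Fin n) (Fin n) k) := by
            simp only [mul_assoc]
      _ = _ := by rw [hg]; simp only [mul_assoc, mul_one]

theorem evalMat_surj {n m : ℕ} (x : MTuple k n m) (hx : x ∈ genTuples k n m)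
    (M : Matrix (Fin n) (Fin n) k) : ∃ p ∈ GMN k n m, evalMat k x p = M := by
  have h1 : (GMN k n m).map (evalMat k x) = ⊤ := by
    rw [GMN, AlgHom.map_adjoin, ← Set.range_comp]
    have : (evalMat k x ∘ genericMatrix k n m) = x := funext fun h => evalMat_generic k x h
    rw [this]
    exact hx
  have : M ∈ (GMN k n m).map (evalMat k x) := h1 ▸ Algebra.mem_top
  exact this

theorem central_scalar {n m : ℕ} (x : MTuple k n m) (hx : x ∈ genTuples k n m)
    (c : MatPoly k n m) (hc : ∀ r ∈ GMN k n m, c * r = r * c) (z : Fin n) :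
    evalMat k x c = algebraMap k _ (polyEval k x (c z z)) := by
  have : evalMat k x c ∈ Set.range (Matrix.scalar (Fin n)) := by
    rw [Matrix.mem_range_scalar_iff_commute_single']
    intro i j
    obtain ⟨r, hr, h⟩ := evalMat_surj k x hx (Matrix.single i j 1)
    rw [← h]
    have := congrArg (evalMat k x) (hc r hr)
    rw [map_mul, map_mul] at this
    exact this.symm
  obtain ⟨s, hs⟩ := this
  have h2 : polyEval k x (c z z) = s := by
    have : polyEval k x (c z z) = evalMat k x c z z := rfl
    rw [this, ← hs]; simp
  rw [h2, ← hs]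
  rfl

theorem transfer {n m : ℕ} (X : Set (MTuple k n m)) (P : MatPoly k n m) (q : PolyRing k n m)
    (heq : ∀ g : GL (Fin n) k, ∀ x ∈ X, polyEval k x q ≠ 0 → polyEval k (conjAct k g x) q ≠ 0 →
        (polyEval k (conjAct k g x) q)⁻¹ • evalMat k (conjAct k g x) P =
          (g : Matrix (Fin n) (Fin n) k) * ((polyEval k x q)⁻¹ • evalMat k x P) *
            ((g⁻¹ : GL (Fin n) k) : Matrix (Fin n) (Fin n) k))
    {Ω : Type} [Field Ω] [Algebra k Ω] (σ τ : PolyRing k n m →ₐ[k] Ω)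
    (hσ : ∀ p ∈ vanI k X, σ p = 0) (g : GL (Fin n) Ω)
    (hτ : ∀ h, τ.mapMatrix (genericMatrix k n m h) = (g : Matrix (Fin n) (Fin n) Ω) *
      σ.mapMatrix (genericMatrix k n m h) * ((g⁻¹ : GL (Fin n) Ω) : Matrix (Fin n) (Fin n) Ω))
    (hσq : σ q ≠ 0) (hτq : τ q ≠ 0) :
    σ q • τ.mapMatrix P = τ q • ((g : Matrix (Fin n) (Fin n) Ω) *
      σ.mapMatrix P * ((g⁻¹ : GL (Fin n) Ω) : Matrix (Fin n) (Fin n) Ω)) := by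
  let B := MvPolynomial (Fin n × Fin n) (PolyRing k n m)
  let G0 : Matrix (Fin n) (Fin n) B := Matrix.of fun i j => MvPolynomial.X (i, j)
  let d : B := G0.det
  let Bd := Localization.Away d
  let G : Matrix (Fin n) (Fin n) Bd := (algebraMap B Bd).mapMatrix G0
  have hGdet : IsUnit G.det := by
    rw [← RingHom.map_det]
    exact IsLocalization.Away.algebraMap_isUnit d
  let ψ0 : PolyRing k n m →ₐ[k] Bd :=
    (IsScalarTower.toAlgHom k B Bd).comp (IsScalarTower.toAlgHom k (PolyRing k n m) B)
  let ψ : PolyRing k n m →ₐ[k] Bd := MvPolynomial.aeval fun x : MIdx n m =>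
    (G * ψ0.mapMatrix (genericMatrix k n m x.1) * G⁻¹) x.2.1 x.2.2
  -- evaluation
  have key : ∀ (E : Type) [Field E] [Algebra k E] (χ χ' : PolyRing k n m →ₐ[k] E) (γ : GL (Fin n) E),
      (∀ h, χ'.mapMatrix (genericMatrix k n m h) = (γ : Matrix (Fin n) (Fin n) E) *
      χ.mapMatrix (genericMatrix k n m h) * ((γ⁻¹ : GL (Fin n) E) : Matrix (Fin n) (Fin n) E)) →
      ∃ l : Bd →+* E, (∀ p, l (algebraMap B Bd p) =
          MvPolynomial.eval₂Hom χ.toRingHom (fun ij => (γ : Matrix (Fin n) (Fin n) E) ij.1 ij.2) p) ∧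
        (∀ p, l (ψ0 p) = χ p) ∧ (∀ p, l (ψ p) = χ' p) ∧
        l.mapMatrix G = (γ : Matrix (Fin n) (Fin n) E) ∧
        l.mapMatrix G⁻¹ = ((γ⁻¹ : GL (Fin n) E) : Matrix (Fin n) (Fin n) E) ∧
        MvPolynomial.eval₂Hom χ.toRingHom (fun ij => (γ : Matrix (Fin n) (Fin n) E) ij.1 ij.2) d ≠ 0 := by
    intro E _ _ χ χ' γ hχ
    set l0 : B →+* E := MvPolynomial.eval₂Hom χ.toRingHom
      (fun ij => (γ : Matrix (Fin n) (Fin n) E) ij.1 ij.2) with hl0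
    have hG0 : l0.mapMatrix G0 = (γ : Matrix (Fin n) (Fin n) E) := by
      ext i j
      exact MvPolynomial.eval₂Hom_X' _ _ _
    have hd : l0 d ≠ 0 := by
      have : l0 d = (γ : Matrix (Fin n) (Fin n) E).det := by
        rw [← hG0, ← RingHom.map_det]
      rw [this]
      exact ((Matrix.isUnit_iff_isUnit_det _).mp γ.isUnit).ne_zero
    let l : Bd →+* E := IsLocalization.Away.lift d (g := l0) (IsUnit.mk0 _ hd)
    have hl : ∀ p, l (algebraMap B Bd p) = l0 p := fun p => IsLocalization.Away.lift_eq d _ p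
    have hlG : l.mapMatrix G = (γ : Matrix (Fin n) (Fin n) E) := by
      rw [← hG0]
      ext i j
      simp [G, hl]
    have hlGi : l.mapMatrix G⁻¹ = ((γ⁻¹ : GL (Fin n) E) : Matrix (Fin n) (Fin n) E) := by
      have h1 : l.mapMatrix G * l.mapMatrix G⁻¹ = 1 := by
        rw [← map_mul, Matrix.mul_nonsing_inv _ hGdet, map_one]
      rw [hlG] at h1
      exact (Units.inv_eq_of_mul_eq_one_right h1).symm
    have hl0' : ∀ p, l (ψ0 p) = χ p := by
      intro p
      have : ψ0 p = algebraMap B Bd (MvPolynomial.C p) := rfl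
      rw [this, hl]
      exact MvPolynomial.eval₂Hom_C _ _ _
    refine ⟨l, hl, hl0', ?_, hlG, hlGi, hd⟩
    intro p
    have hk : ∀ r : k, l (algebraMap k Bd r) = algebraMap k E r := by
      intro r
      rw [← ψ0.commutes, hl0', χ.commutes]
    let lA : Bd →ₐ[k] E := { l with commutes' := hk }
    have : lA.comp ψ = χ' := by
      apply MvPolynomial.algHom_ext
      rintro ⟨h, i, j⟩
      have h1 : χ' (MvPolynomial.X (h, i, j)) = χ'.mapMatrix (genericMatrix k n m h) i j := by
        simp [genericMatrix]
      rw [h1, hχ]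
      have h2 : (lA.comp ψ) (MvPolynomial.X (h, i, j)) =
          l.mapMatrix (G * ψ0.mapMatrix (genericMatrix k n m h) * G⁻¹) i j := by
        simp only [AlgHom.comp_apply, ψ, MvPolynomial.aeval_X]
        rfl
      have hM : l.mapMatrix (ψ0.mapMatrix (genericMatrix k n m h)) =
          χ.mapMatrix (genericMatrix k n m h) := by
        ext a b
        exact hl0' _
      rw [h2, map_mul, map_mul, hlG, hlGi, hM]
    rw [← this]
    rfl
  ext i j
  let J : Bd := ψ0 q * ψ q * (ψ0 q * ψ (P i j) - ψ q * (G * ψ0.mapMatrix P * G⁻¹) i j)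
  obtain ⟨⟨num, ⟨_, ⟨N, rfl⟩⟩⟩, hnum⟩ := IsLocalization.surj (Submonoid.powers d) J
  simp only at hnum
  have lJ : ∀ (E : Type) [Field E] [Algebra k E] (χ χ' : PolyRing k n m →ₐ[k] E) (γ : GL (Fin n) E)
      (l : Bd →+* E), (∀ p, l (ψ0 p) = χ p) → (∀ p, l (ψ p) = χ' p) →
        l.mapMatrix G = (γ : Matrix (Fin n) (Fin n) E) →
        l.mapMatrix G⁻¹ = ((γ⁻¹ : GL (Fin n) E) : Matrix (Fin n) (Fin n) E) →
        l J = χ q * χ' q * (χ q * χ' (P i j) - χ' q * ((γ : Matrix (Fin n) (Fin n) E) *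
          χ.mapMatrix P * ((γ⁻¹ : GL (Fin n) E) : Matrix (Fin n) (Fin n) E)) i j) := by
    intro E _ _ χ χ' γ l h1 h2 h3 h4
    have h5 : l ((G * ψ0.mapMatrix P * G⁻¹) i j) = ((γ : Matrix (Fin n) (Fin n) E) *
          χ.mapMatrix P * ((γ⁻¹ : GL (Fin n) E) : Matrix (Fin n) (Fin n) E)) i j := by
      change l.mapMatrix (G * ψ0.mapMatrix P * G⁻¹) i j = _
      have hM : l.mapMatrix (ψ0.mapMatrix P) = χ.mapMatrix P := by
        ext a b
        exact h1 _
      rw [map_mul, map_mul, h3, h4, hM]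
    simp only [J, map_mul, map_sub, h1, h2, h5]
  -- vanishing over k
  have hvan : ∀ x ∈ X, MvPolynomial.map (polyEval k x).toRingHom (num * d) = 0 := by
    intro x hx
    apply MvPolynomial.funext
    intro v
    rw [map_zero, MvPolynomial.eval_map, ← MvPolynomial.coe_eval₂Hom]
    by_cases hv : IsUnit (Matrix.of fun i j => v (i, j)).det
    · let γ : GL (Fin n) k := Matrix.GeneralLinearGroup.mk'' (Matrix.of fun i j => v (i, j)) hv
      have hγ : (fun ij : Fin n × Fin n => (γ : Matrix (Fin n) (Fin n) k) ij.1 ij.2) = v := rfl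
      obtain ⟨l, hl, h1, h2, h3, h4, h5⟩ := key k (polyEval k x) (polyEval k (conjAct k γ x)) γ (by
        intro h
        exact (evalMat_generic k _ h).trans (by
          rw [conjAct]
          congr 2
          exact (evalMat_generic k _ h).symm))
      have h6 := lJ k _ _ γ l h1 h2 h3 h4
      have h7 : l J = 0 := by
        rw [h6]
        by_cases hq1 : polyEval k x q = 0
        · rw [hq1]; simp
        by_cases hq2 : polyEval k (conjAct k γ x) q = 0
        · rw [hq2]; simp
        have h8 := congrFun (congrFun (heq γ x hx hq1 hq2) i) j
        rw [mul_smul_comm, smul_mul_assoc, Matrix.smul_apply, Matrix.smul_apply] at h8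
        have h9 : evalMat k (conjAct k γ x) P i j = polyEval k (conjAct k γ x) (P i j) := rfl
        rw [h9] at h8
        change _ = (polyEval k x q)⁻¹ • ((γ : Matrix (Fin n) (Fin n) k) *
          (polyEval k x).mapMatrix P * ((γ⁻¹ : GL (Fin n) k) : Matrix (Fin n) (Fin n) k)) i j at h8
        generalize ((γ : Matrix (Fin n) (Fin n) k) *
          (polyEval k x).mapMatrix P * ((γ⁻¹ : GL (Fin n) k) : Matrix (Fin n) (Fin n) k)) i j = w at *
        simp only [smul_eq_mul] at h8
        field_simp at h8
        rw [mul_eq_zero]; right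
        rw [sub_eq_zero]
        linear_combination h8
      have h8 := congrArg l hnum
      rw [map_mul, h7, zero_mul, hl, hγ] at h8
      rw [map_mul, ← h8, zero_mul]
    · rw [map_mul]
      have : MvPolynomial.eval₂Hom (polyEval k x).toRingHom v d =
          (Matrix.of fun i j => v (i, j)).det := by
        simp only [d, RingHom.map_det]
        congr 1
        ext i j
        simp [G0]
      rw [this, not_not.mp (fun h => hv (IsUnit.mk0 _ h)), mul_zero]
  have hcoef : ∀ e, MvPolynomial.coeff e (num * d) ∈ vanI k X := by
    intro e x hx
    have := congrArg (MvPolynomial.coeff e) (hvan x hx)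
    rw [MvPolynomial.coeff_map, MvPolynomial.coeff_zero] at this
    exact this
  have hzero : MvPolynomial.map σ.toRingHom (num * d) = 0 := by
    ext e
    rw [MvPolynomial.coeff_map, MvPolynomial.coeff_zero]
    exact hσ _ (hcoef e)
  obtain ⟨l, hl, h1, h2, h3, h4, h5⟩ := key Ω σ τ g hτ
  have h6 := lJ Ω _ _ g l h1 h2 h3 h4
  have h7 : MvPolynomial.eval₂Hom σ.toRingHom
      (fun ij => (g : Matrix (Fin n) (Fin n) Ω) ij.1 ij.2) (num * d) = 0 := by
    rw [MvPolynomial.coe_eval₂Hom, ← MvPolynomial.eval_map, hzero, map_zero]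
  rw [map_mul] at h7
  have h8 := (mul_eq_zero.mp h7).resolve_right h5
  have h9 := congrArg l hnum
  rw [map_mul, hl, hl, h8, mul_eq_zero, map_pow] at h9
  have h10 := h9.resolve_right (pow_ne_zero _ h5)
  rw [h6] at h10
  have h11 := (mul_eq_zero.mp h10).resolve_left (mul_ne_zero hσq hτq)
  rw [sub_eq_zero] at h11
  rw [Matrix.smul_apply, Matrix.smul_apply]
  exact h11

theorem trace_capel_mem {n m : ℕ} (hn : 1 ≤ n) (a c b : Fin (n * n) → MatPoly k n m)
    (ha : ∀ i, a i ∈ GMN k n m) (hc : ∀ i, c i ∈ GMN k n m) (hb : ∀ i, b i ∈ GMN k n m) :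
    algebraMap (PolyRing k n m) (MatPoly k n m) (capel a c b).trace ∈ GMN k n m := by
  have h := capel_central (GMN k n m) a c b ha hc hb
  have h2 := (GMN k n m).smul_mem h ((n : k)⁻¹)
  convert h2 using 1
  have hn' : (n : k) ≠ 0 := by
    rw [Nat.cast_ne_zero]; omega
  have h3 : (n : PolyRing k n m) * (capel a c b).trace = (n : k) • (capel a c b).trace := by
    rw [Algebra.smul_def, map_natCast]
  rw [h3, ← IsScalarTower.coe_toAlgHom' k, map_smul, smul_smul, inv_mul_cancel₀ hn', one_smul]

theorem mapMatrix_capel_trace {R E : Type*} [CommRing R] [CommRing E] {n : ℕ} (f : R →+* E)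
    (a c b : Fin (n * n) → Matrix (Fin n) (Fin n) R) :
    f (capel a c b).trace = (capel (fun i => f.mapMatrix (a i)) (fun i => f.mapMatrix (c i))
      (fun i => f.mapMatrix (b i))).trace := by
  rw [← capel_map, AddMonoidHom.map_trace]
  rfl

theorem surjectivity_part {n m : ℕ} (hn : 1 ≤ n) (X : Set (MTuple k n m)) (hX : IsNVariety k X)
    (hirr : IsIrredSubset k X) (P : MatPoly k n m) (q : PolyRing k n m)
    (hq : ∃ x ∈ X, polyEval k x q ≠ 0)
    (heq : ∀ g : GL (Fin n) k, ∀ x ∈ X, polyEval k x q ≠ 0 → polyEval k (conjAct k g x) q ≠ 0 →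
        (polyEval k (conjAct k g x) q)⁻¹ • evalMat k (conjAct k g x) P =
          (g : Matrix (Fin n) (Fin n) k) * ((polyEval k x q)⁻¹ • evalMat k x P) *
            ((g⁻¹ : GL (Fin n) k) : Matrix (Fin n) (Fin n) k)) :
      ∃ p c : MatPoly k n m, p ∈ GMN k n m ∧ c ∈ GMN k n m ∧
        (∀ r ∈ GMN k n m, c * r = r * c) ∧ (∃ x ∈ X, evalMat k x c ≠ 0) ∧
        (∀ x ∈ X, polyEval k x q • evalMat k x p = evalMat k x c * evalMat k x P) := by
  have hprime := vanI_prime k X hirr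
  obtain ⟨x0, hx0, hqx0⟩ := hq
  let z : Fin n := ⟨0, hn⟩
  -- lifts of matrix units
  choose lift hliftG hlift using evalMat_surj k x0 (hX.1 hx0)
  let a : Fin (n * n) → MatPoly k n m := fun i => lift (uA k n z i)
  let c : Fin (n * n) → MatPoly k n m := fun i => lift (uC k n z i)
  let b : Fin (n * n) → MatPoly k n m := fun i => lift (eB k n i)
  have ha : ∀ i, a i ∈ GMN k n m := fun i => hliftG _
  have hc : ∀ i, c i ∈ GMN k n m := fun i => hliftG _
  have hb : ∀ i, b i ∈ GMN k n m := fun i => hliftG _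
  have hδ0 : polyEval k x0 (capel a c b).trace = 1 := by
    have h1 := mapMatrix_capel_trace (polyEval k x0).toRingHom a c b
    have h2 : ∀ M, (polyEval k x0).toRingHom.mapMatrix (lift M) = M := hlift
    simp only [a, c, b, h2] at h1
    rw [capel_units] at h1
    exact h1
  -- the function field
  let L := FractionRing (PolyRing k n m ⧸ vanI k X)
  let φ : PolyRing k n m →ₐ[k] L :=
    (IsScalarTower.toAlgHom k (PolyRing k n m ⧸ vanI k X) L).comp (Ideal.Quotient.mkₐ k (vanI k X))
  have hφ : ∀ p, φ p = 0 ↔ p ∈ vanI k X := by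
    intro p
    have : φ p = algebraMap (PolyRing k n m ⧸ vanI k X) L (Ideal.Quotient.mk _ p) := rfl
    rw [this, ← Ideal.Quotient.eq_zero_iff_mem]
    exact (FaithfulSMul.algebraMap_eq_zero_iff _ _)
  have hφq : φ q ≠ 0 := fun h => hqx0 ((hφ q).mp h x0 hx0)
  have hcz : CharZero L := charZero_of_injective_algebraMap (algebraMap k L).injective
  let Φ : MatPoly k n m →+* Matrix (Fin n) (Fin n) L := φ.toRingHom.mapMatrix
  let Z0 : Subring (PolyRing k n m) :=
    (GMN k n m).toSubring.comap (algebraMap (PolyRing k n m) (MatPoly k n m))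
  let Zs : Subring L := Z0.map φ.toRingHom
  let K : Subfield L := Subfield.closure (Zs : Set L)
  have hZK : ∀ t ∈ Z0, φ t ∈ K := fun t ht => Subfield.subset_closure ⟨t, ht, rfl⟩
  let A' := fun i => Φ (a i)
  let C' := fun i => Φ (c i)
  let B' := fun i => Φ (b i)
  have hδ : (capel A' C' B').trace = φ (capel a c b).trace :=
    (mapMatrix_capel_trace φ.toRingHom a c b).symm
  have hδne : (capel A' C' B').trace ≠ 0 := by
    rw [hδ]
    intro h
    have := (hφ _).mp h x0 hx0
    rw [hδ0] at this
    exact one_ne_zero this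
  obtain ⟨hli, hcr⟩ := cramer_capel A' C' B' hδne
  let κ : Matrix (Fin n) (Fin n) L → Fin (n * n) → L := fun r i =>
    (capel A' C' (Function.update B' i r)).trace / (capel A' C' B').trace
  have hcr : ∀ r, r = ∑ i, κ r i • B' i := hcr
  have hκK : ∀ r ∈ GMN k n m, ∀ i, κ (Φ r) i ∈ K := by
    intro r hr i
    refine div_mem ?_ ?_
    · have h1 : (capel A' C' (Function.update B' i (Φ r))).trace =
          φ (capel a c (Function.update b i r)).trace := by
        refine Eq.trans ?_ (mapMatrix_capel_trace φ.toRingHom a c (Function.update b i r)).symm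
        congr 2
        funext j
        by_cases hj : j = i
        · subst hj; simp [Φ]
        · simp [hj, B', Φ]
      rw [h1]
      refine hZK _ (trace_capel_mem k hn a c _ ha hc ?_)
      intro j
      by_cases hj : j = i
      · subst hj; simpa using hr
      · simpa [hj] using hb j
    · rw [hδ]
      exact hZK _ (trace_capel_mem k hn a c b ha hc hb)
  -- the rational map
  let F : Matrix (Fin n) (Fin n) L := (φ q)⁻¹ • Φ P
  have hF : ∀ i, κ F i ∈ K := by
    intro i
    by_contra hi
    have hczK : CharZero K := charZero_of_injective_algebraMap (R := ℚ) (algebraMap ℚ K).injective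
    obtain ⟨Ω, iΩ, s, t, hst, hne⟩ := field_separate (K := K) (κ F i) (by
      rintro ⟨y, hy⟩
      exact hi (hy ▸ y.2))
    have hst : ∀ y ∈ K, s y = t y := fun y hy => hst ⟨y, hy⟩
    let : Algebra k Ω := (s.comp (algebraMap k L)).toAlgebra
    let sA : L →ₐ[k] Ω := { s with commutes' := fun r => rfl }
    have htk : ∀ r : k, t (algebraMap k L r) = s (algebraMap k L r) := by
      intro r
      have h1 : algebraMap k L r ∈ K := by
        have : φ (algebraMap k _ r) = algebraMap k L r := φ.commutes r
        rw [← this]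
        refine hZK _ ?_
        change algebraMap _ _ (algebraMap k (PolyRing k n m) r) ∈ GMN k n m
        rw [← IsScalarTower.algebraMap_apply]
        exact (GMN k n m).algebraMap_mem r
      exact (hst _ h1).symm
    let tA : L →ₐ[k] Ω := { t with commutes' := htk }
    have hexp : ∀ (v : L →+* Ω) (r : Matrix (Fin n) (Fin n) L),
        v.mapMatrix r = ∑ l, v (κ r l) • v.mapMatrix (B' l) := by
      intro v r
      conv_lhs => rw [hcr r]
      rw [map_sum]
      refine Finset.sum_congr rfl fun l _ => ?_
      ext i j
      simp
    have hind : ∀ (v : L →+* Ω), LinearIndependent Ω (fun l => v.mapMatrix (B' l)) := by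
      intro v
      refine (cramer_capel (fun l => v.mapMatrix (A' l)) (fun l => v.mapMatrix (C' l)) _ ?_).1
      rw [← mapMatrix_capel_trace]
      exact fun h => hδne (v.injective (h.trans (map_zero v).symm))
    have hexpG : ∀ r ∈ GMN k n m, t.mapMatrix (Φ r) = ∑ l, s (κ (Φ r) l) • t.mapMatrix (B' l) := by
      intro r hr
      rw [hexp t]
      refine Finset.sum_congr rfl fun l _ => ?_
      rw [hst _ (hκK r hr l)]
    obtain ⟨g, hg⟩ := skolem_basis (fun l => s.mapMatrix (B' l)) (fun l => t.mapMatrix (B' l)) rfl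
      (hind s) (hind t) (fun i j l => s (κ (Φ (b i * b j)) l))
      (fun i j => by
        rw [← hexp s, map_mul, map_mul])
      (fun i j => by
        rw [← hexpG _ (mul_mem (hb i) (hb j)), map_mul, map_mul])
      (fun l => s (κ (Φ 1) l))
      (by rw [← hexp s, map_one, map_one]) (by rw [← hexpG _ (one_mem _), map_one, map_one])
    have hconj : ∀ r ∈ GMN k n m, t.mapMatrix (Φ r) = (g : Matrix (Fin n) (Fin n) Ω) *
        s.mapMatrix (Φ r) * ((g⁻¹ : GL (Fin n) Ω) : Matrix (Fin n) (Fin n) Ω) := by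
      intro r hr
      rw [hexpG r hr, hexp s, Finset.mul_sum, Finset.sum_mul]
      refine Finset.sum_congr rfl fun l _ => ?_
      rw [hg l, mul_smul_comm, smul_mul_assoc]
    have hsq : s (φ q) ≠ 0 := fun h => hφq (s.injective (h.trans (map_zero s).symm))
    have htq : t (φ q) ≠ 0 := fun h => hφq (t.injective (h.trans (map_zero t).symm))
    have htr := transfer k X P q heq (sA.comp φ) (tA.comp φ)
      (fun p hp => by
        have : φ p = 0 := (hφ p).mpr hp
        rw [AlgHom.comp_apply, this, map_zero]) g
      (fun h => hconj _ (Algebra.subset_adjoin ⟨h, rfl⟩)) hsq htq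
    have htr : s (φ q) • t.mapMatrix (Φ P) = t (φ q) • ((g : Matrix (Fin n) (Fin n) Ω) *
        s.mapMatrix (Φ P) * ((g⁻¹ : GL (Fin n) Ω) : Matrix (Fin n) (Fin n) Ω)) := htr
    have hFv : ∀ v : L →+* Ω, v.mapMatrix F = (v (φ q))⁻¹ • v.mapMatrix (Φ P) := by
      intro v
      ext i j
      simp [F]
      exact Or.inl (map_inv₀ v _)
    have hFt : t.mapMatrix F = (g : Matrix (Fin n) (Fin n) Ω) *
        s.mapMatrix F * ((g⁻¹ : GL (Fin n) Ω) : Matrix (Fin n) (Fin n) Ω) := by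
      rw [hFv, hFv, mul_smul_comm, smul_mul_assoc, inv_smul_eq_iff₀ htq, smul_comm,
        eq_inv_smul_iff₀ hsq]
      exact htr
    have hsum : ∑ l, t (κ F l) • t.mapMatrix (B' l) = ∑ l, s (κ F l) • t.mapMatrix (B' l) := by
      rw [← hexp t, hFt, hexp s, Finset.mul_sum, Finset.sum_mul]
      refine Finset.sum_congr rfl fun l _ => ?_
      rw [hg l, mul_smul_comm, smul_mul_assoc]
    have hz : ∑ l, (t (κ F l) - s (κ F l)) • t.mapMatrix (B' l) = 0 := by
      simp only [sub_smul, Finset.sum_sub_distrib, hsum, sub_self]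
    have := Fintype.linearIndependent_iff.mp (hind t) _ hz i
    exact hne (sub_eq_zero.mp this).symm
  -- clear denominators
  have hfrac : ∀ i, ∃ y ∈ Z0, ∃ w ∈ Z0, φ w ≠ 0 ∧ φ w * κ F i = φ y := by
    intro i
    obtain ⟨y, hy, w, hw, h⟩ := Subfield.mem_closure_iff.mp (hF i)
    rw [Subring.closure_eq] at hy hw
    obtain ⟨y, hy, rfl⟩ := hy
    obtain ⟨w, hw, rfl⟩ := hw
    by_cases h0 : φ w = 0
    · refine ⟨0, zero_mem _, 1, one_mem _, by rw [map_one]; exact one_ne_zero, ?_⟩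
      have h0' : φ.toRingHom w = 0 := h0
      rw [h0', div_zero] at h
      rw [← h]; simp
    · refine ⟨y, hy, w, hw, h0, ?_⟩
      rw [← h]
      exact mul_div_cancel₀ _ h0
  choose y hy w hw hw0 hyw using hfrac
  let T : PolyRing k n m := ∏ i, w i
  have hT : T ∈ Z0 := prod_mem fun i _ => hw i
  have hφT : φ T ≠ 0 := by
    rw [map_prod]
    exact Finset.prod_ne_zero_iff.mpr fun i _ => hw0 i
  let S : Fin (n * n) → PolyRing k n m := fun i => (∏ j ∈ Finset.univ.erase i, w j) * y i
  have hS : ∀ i, S i ∈ Z0 := fun i => mul_mem (prod_mem fun j _ => hw j) (hy i)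
  have hST : ∀ i, φ (S i) = φ T * κ F i := by
    intro i
    have : T = (∏ j ∈ Finset.univ.erase i, w j) * w i :=
      (Finset.prod_erase_mul _ _ (Finset.mem_univ i)).symm
    rw [this, map_mul, map_mul, ← hyw i, mul_assoc]
  refine ⟨∑ i, algebraMap _ _ (S i) * b i, algebraMap _ _ T,
    sum_mem fun i _ => mul_mem (hS i) (hb i), hT, fun r _ => Algebra.commutes _ _, ?_, ?_⟩
  · by_contra hcon
    push Not at hcon
    apply hφT
    rw [hφ]
    intro x hx
    have h1 := congrFun (congrFun (hcon x hx) z) z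
    simpa [evalMat, Matrix.algebraMap_matrix_apply] using h1
  · have hΦp : φ q • Φ (∑ i, algebraMap _ _ (S i) * b i) = φ T • Φ P := by
      have h1 : Φ (∑ i, algebraMap _ _ (S i) * b i) = φ T • F := by
        rw [map_sum]
        conv_rhs => rw [hcr F]
        rw [Finset.smul_sum]
        refine Finset.sum_congr rfl fun i _ => ?_
        rw [← Algebra.smul_def, smul_smul, ← hST]
        ext i j
        simp [Φ, B']
      rw [h1, smul_comm]
      simp only [F]
      rw [smul_inv_smul₀ hφq]
    intro x hx
    ext i j
    have h2 := congrFun (congrFun hΦp i) j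
    have h3 : φ (q * (∑ i, algebraMap _ _ (S i) * b i : MatPoly k n m) i j - T * P i j) = 0 := by
      rw [map_sub, map_mul, map_mul, sub_eq_zero]
      exact h2
    have h4 := (hφ _).mp h3 x hx
    rw [map_sub, map_mul, map_mul, sub_eq_zero] at h4
    have h5 : evalMat k x (algebraMap _ _ T) = algebraMap k _ (polyEval k x T) := by
      ext i j
      by_cases hij : i = j
      · subst hij; simp [evalMat, Matrix.algebraMap_matrix_apply]
      · simp [evalMat, Matrix.algebraMap_matrix_apply, hij]
    rw [h5, ← Algebra.smul_def]
    exact h4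

/-- **Statement 17** (Proposition prop.rat2).  Let `X ⊆ U_{m,n}` be an
irreducible `n`-variety.  The natural inclusion of `k_n(X)` — the total ring of
fractions of `k_n[X]`, whose elements are the `PGL_n`-equivariant rational maps
`c⁻¹p : X ⇢ M_n` with `p ∈ k_n[X]` and `c` a nonzero central element of
`k_n[X]` — into the `k`-algebra of all `PGL_n`-equivariant rational maps
`X ⇢ M_n` is an isomorphism.  Here an arbitrary rational map `X ⇢ M_n` is given
entrywise by quotients of polynomials, i.e. by a matrix `P` of polynomials and a
common denominator `q` not vanishing identically on `X`, sending
`x ↦ q(x)⁻¹·P(x)`; `PGL_n`-equivariance is required on the domain of definition.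
The three clauses below say respectively that the inclusion is well defined
(every `c⁻¹p` is an equivariant rational map), injective, and surjective (every
equivariant rational map can be written as `c⁻¹p`, equality being as rational
maps, i.e. after cross-multiplying, everywhere on `X`). -/
theorem equivariant_rational_maps_are_central_fractions
    (n m : ℕ) (hn : 1 ≤ n) (hm : 2 ≤ m)
    (X : Set (MTuple k n m)) (hX : IsNVariety k X) (hirr : IsIrredSubset k X) :
    -- well-definedness of the inclusion: elements of k_n(X) are equivariant rational maps
    (∀ p c : MatPoly k n m, p ∈ GMN k n m → c ∈ GMN k n m →
      (∀ r ∈ GMN k n m, c * r = r * c) → (∃ x ∈ X, evalMat k x c ≠ 0) →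
      ∀ g : GL (Fin n) k, ∀ x ∈ X, evalMat k x c ≠ 0 → evalMat k (conjAct k g x) c ≠ 0 →
        (evalMat k (conjAct k g x) c)⁻¹ * evalMat k (conjAct k g x) p =
          (g : Matrix (Fin n) (Fin n) k) * ((evalMat k x c)⁻¹ * evalMat k x p) *
            ((g⁻¹ : GL (Fin n) k) : Matrix (Fin n) (Fin n) k)) ∧
    -- injectivity: two central fractions agreeing as rational maps on X agree in k_n(X)
    (∀ p c p' c' : MatPoly k n m, p ∈ GMN k n m → c ∈ GMN k n m → p' ∈ GMN k n m →
      c' ∈ GMN k n m → (∀ r ∈ GMN k n m, c * r = r * c) → (∀ r ∈ GMN k n m, c' * r = r * c') →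
      (∃ x ∈ X, evalMat k x c ≠ 0) → (∃ x ∈ X, evalMat k x c' ≠ 0) →
      (∀ x ∈ X, evalMat k x c ≠ 0 → evalMat k x c' ≠ 0 →
        (evalMat k x c)⁻¹ * evalMat k x p = (evalMat k x c')⁻¹ * evalMat k x p') →
      ∀ x ∈ X, evalMat k x c' * evalMat k x p = evalMat k x c * evalMat k x p') ∧
    -- surjectivity: every PGL_n-equivariant rational map X ⇢ M_n is of the form c⁻¹p
    (∀ (P : MatPoly k n m) (q : PolyRing k n m),
      (∃ x ∈ X, polyEval k x q ≠ 0) →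
      (∀ g : GL (Fin n) k, ∀ x ∈ X, polyEval k x q ≠ 0 → polyEval k (conjAct k g x) q ≠ 0 →
        (polyEval k (conjAct k g x) q)⁻¹ • evalMat k (conjAct k g x) P =
          (g : Matrix (Fin n) (Fin n) k) * ((polyEval k x q)⁻¹ • evalMat k x P) *
            ((g⁻¹ : GL (Fin n) k) : Matrix (Fin n) (Fin n) k)) →
      ∃ p c : MatPoly k n m, p ∈ GMN k n m ∧ c ∈ GMN k n m ∧
        (∀ r ∈ GMN k n m, c * r = r * c) ∧ (∃ x ∈ X, evalMat k x c ≠ 0) ∧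
        (∀ x ∈ X, polyEval k x q • evalMat k x p = evalMat k x c * evalMat k x P)) := by
  have hprime := vanI_prime k X hirr
  refine ⟨?_, ?_, fun P q hq heq => surjectivity_part k hn X hX hirr P q hq heq⟩
  · intro p c hp hc _ _ g x _ _ _
    rw [evalMat_conj k g x p hp, evalMat_conj k g x c hc, Matrix.mul_inv_rev, Matrix.mul_inv_rev]
    have hg : (((g⁻¹ : GL (Fin n) k) : Matrix (Fin n) (Fin n) k))⁻¹ =
        (g : Matrix (Fin n) (Fin n) k) := by
      rw [Matrix.coe_units_inv, Matrix.nonsing_inv_nonsing_inv]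
      exact (Matrix.isUnit_iff_isUnit_det _).mp g.isUnit
    have hg2 : ((g : Matrix (Fin n) (Fin n) k))⁻¹ * (g : Matrix (Fin n) (Fin n) k) = 1 :=
      Matrix.nonsing_inv_mul _ ((Matrix.isUnit_iff_isUnit_det _).mp g.isUnit)
    rw [hg]
    simp only [mul_assoc]
    rw [← mul_assoc ((g : Matrix (Fin n) (Fin n) k))⁻¹ (g : Matrix (Fin n) (Fin n) k), hg2, one_mul]
  · intro p c p' c' _ _ _ _ hc hc' hcx hcx' h x hx
    let z : Fin n := ⟨0, hn⟩
    have hs := fun x (hx : x ∈ X) => central_scalar k x (hX.1 hx) c hc z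
    have hs' := fun x (hx : x ∈ X) => central_scalar k x (hX.1 hx) c' hc' z
    have hne : c z z ∉ vanI k X := by
      intro hmem
      obtain ⟨x, hx, h0⟩ := hcx
      exact h0 (by rw [hs x hx, hmem x hx, map_zero])
    have hne' : c' z z ∉ vanI k X := by
      intro hmem
      obtain ⟨x, hx, h0⟩ := hcx'
      exact h0 (by rw [hs' x hx, hmem x hx, map_zero])
    ext i j
    have key : (c z z * c' z z) * (c' z z * p i j - c z z * p' i j) ∈ vanI k X := by
      intro y hy
      simp only [map_mul, map_sub]
      by_cases h1 : polyEval k y (c z z) = 0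
      · rw [h1]; simp
      by_cases h2 : polyEval k y (c' z z) = 0
      · rw [h2]; simp
      have hinj : Function.Injective (algebraMap k (Matrix (Fin n) (Fin n) k)) := by
        have : Nonempty (Fin n) := ⟨z⟩
        exact (algebraMap k (Matrix (Fin n) (Fin n) k)).injective
      have h3 := h y hy
        (by rw [hs y hy]; exact fun h0 => h1 (hinj (h0.trans (map_zero _).symm)))
        (by rw [hs' y hy]; exact fun h0 => h2 (hinj (h0.trans (map_zero _).symm)))
      rw [hs y hy, hs' y hy] at h3
      have hinv : ∀ s : k, s ≠ 0 → (algebraMap k (Matrix (Fin n) (Fin n) k) s)⁻¹ =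
          algebraMap k _ s⁻¹ := by
        intro s hs0
        refine Matrix.inv_eq_left_inv ?_
        rw [← map_mul, inv_mul_cancel₀ hs0, map_one]
      rw [hinv _ h1, hinv _ h2, ← Algebra.smul_def, ← Algebra.smul_def] at h3
      have h4 : (polyEval k y (c z z))⁻¹ * polyEval k y (p i j) =
          (polyEval k y (c' z z))⁻¹ * polyEval k y (p' i j) := congrFun (congrFun h3 i) j
      field_simp at h4
      rw [mul_eq_zero]; right
      rw [sub_eq_zero]
      linear_combination h4
    have h5 := ((hprime.mem_or_mem key).resolve_left
      (fun hm => (hprime.mem_or_mem hm).elim hne hne')) x hx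
    rw [map_sub, map_mul, map_mul, sub_eq_zero] at h5
    rw [hs x hx, hs' x hx, ← Algebra.smul_def, ← Algebra.smul_def]
    exact h5


end
end
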